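/- arXiv:1310.2882 — 6 statements merged into one kernel-verified Lean document; each statement's English description precedes it below -/
import Mathlib

section
/- (Normalized Leaf Entropy Lemma) Let L be a complete leaf set over a finite alphabet Z with branching set B, let P_Y be a probability distribution on L with node probabilities Q and branching distributions P_{Y_t}, and let P_B(t) := Q(t)/E[ℓ(Y)] for t ∈ B. Then the entropy rate of the code equals the P_B-average branching entropy: H(P_Y) / E[ℓ(Y)] = Σ_{t ∈ B} P_B(t) H(P_{Y_t}), where terms with Q(t) = 0 are taken to be 0. -/
open Finset

noncomputable section

/-- A finite set of nonempty strings over `Z` is a *complete leaf set* if it is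
prefix-free and every sufficiently long string over `Z` has exactly one prefix in it
(equivalently, it is the leaf set of a finite rooted tree in which every branching
node has exactly `|Z|` children, one per letter). -/
def IsCompleteLeafSet {Z : Type*} (L : Finset (List Z)) : Prop :=
  (∀ t ∈ L, t ≠ []) ∧
  (∀ s ∈ L, ∀ t ∈ L, s <+: t → s = t) ∧
  (∃ N : ℕ, ∀ s : List Z, N ≤ s.length → ∃! t, t ∈ L ∧ t <+: s)

/-- The branching set: all proper prefixes of leaves, including the root `[]`. -/
def branchSet {Z : Type*} [DecidableEq Z] (L : Finset (List Z)) : Finset (List Z) :=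
  L.biUnion fun t => (Finset.range t.length).image fun i => t.take i

/-- Node probability `Q(t)`: total probability of the leaves having `t` as a prefix. -/
def nodeProb {Z : Type*} [DecidableEq Z] (L : Finset (List Z)) (P : List Z → ℝ)
    (t : List Z) : ℝ :=
  ∑ s ∈ L.filter (fun s => t <+: s), P s

/-- Branching distribution `P_{Y_t}(z) = Q(tz)/Q(t)` (junk value `0` when `Q(t) = 0`,
so that terms with `Q(t) = 0` vanish). -/
def branchDist {Z : Type*} [DecidableEq Z] (L : Finset (List Z)) (P : List Z → ℝ)
    (t : List Z) (z : Z) : ℝ :=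
  nodeProb L P (t ++ [z]) / nodeProb L P t

/-- Expected leaf depth `E[ℓ(Y)]`. -/
def expLen {Z : Type*} (L : Finset (List Z)) (P : List Z → ℝ) : ℝ :=
  ∑ t ∈ L, P t * t.length

/-- Shannon entropy in bits of `P` on the finite set `S` (terms with `P x = 0` vanish). -/
def ent {α : Type*} (S : Finset α) (P : α → ℝ) : ℝ :=
  ∑ x ∈ S, -(P x * Real.logb 2 (P x))

/-- Informational divergence in bits of `P` from `P'` on `S` (terms with `P x = 0` vanish). -/
def kl {α : Type*} (S : Finset α) (P P' : α → ℝ) : ℝ :=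
  ∑ x ∈ S, P x * Real.logb 2 (P x / P' x)

/-- The leaf distribution induced by a memoryless source: `P_Z^L(t) = ∏ i, P_Z(t_i)`. -/
def inducedProb {Z : Type*} (P : Z → ℝ) (t : List Z) : ℝ :=
  (t.map P).prod

/-- `L¹` (total variation) distance between two distributions on a finite alphabet. -/
def l1dist {Z : Type*} [Fintype Z] (P P' : Z → ℝ) : ℝ :=
  ∑ z, |P z - P' z|

theorem mem_branchSet_iff' {Z : Type*} [DecidableEq Z] (L : Finset (List Z)) (u : List Z) :
    u ∈ branchSet L ↔ ∃ s ∈ L, u <+: s ∧ u ≠ s := by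
  unfold branchSet
  simp only [Finset.mem_biUnion, Finset.mem_image, Finset.mem_range]
  constructor
  · rintro ⟨s, hs, i, hi, rfl⟩
    refine ⟨s, hs, List.take_prefix _ _, fun h => ?_⟩
    have := congrArg List.length h
    simp at this
    omega
  · rintro ⟨s, hs, hp, hne⟩
    refine ⟨s, hs, u.length, ?_, (List.prefix_iff_eq_take.mp hp).symm⟩
    rcases lt_or_eq_of_le hp.length_le with h | h
    · exact h
    · exact absurd (hp.eq_of_length h) hne

theorem nodeProb_nonneg' {Z : Type*} [DecidableEq Z] (L : Finset (List Z)) (P : List Z → ℝ)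
    (hPnn : ∀ t ∈ L, 0 ≤ P t) (t : List Z) : 0 ≤ nodeProb L P t :=
  Finset.sum_nonneg fun s hs => hPnn s (Finset.mem_filter.mp hs).1

theorem sum_nodeProb' {Z : Type*} [Fintype Z] [DecidableEq Z] (L : Finset (List Z))
    (P : List Z → ℝ) (t : List Z) (ht : t ∉ L) :
    ∑ z, nodeProb L P (t ++ [z]) = nodeProb L P t := by
  unfold nodeProb
  simp only [Finset.sum_filter]
  rw [Finset.sum_comm]
  refine Finset.sum_congr rfl fun s hs => ?_
  by_cases h : t <+: s
  · obtain ⟨r, rfl⟩ := h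
    cases r with
    | nil => simp at hs; exact absurd hs ht
    | cons a r =>
      have h2 : ∀ z : Z, (t ++ [z] <+: t ++ a :: r) ↔ z = a := by
        intro z
        rw [List.prefix_append_right_inj]
        simp [List.cons_prefix_cons]
      simp [h2]
  · rw [if_neg h]
    refine Finset.sum_eq_zero fun z _ => if_neg fun h2 => h ((List.prefix_append _ _).trans h2)

theorem node_term' {Z : Type*} [Fintype Z] [DecidableEq Z] (L : Finset (List Z))
    (P : List Z → ℝ) (hPnn : ∀ t ∈ L, 0 ≤ P t) (t : List Z) (ht : t ∉ L) :
    nodeProb L P t * ent Finset.univ (branchDist L P t) =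
      nodeProb L P t * Real.logb 2 (nodeProb L P t) -
      ∑ z, nodeProb L P (t ++ [z]) * Real.logb 2 (nodeProb L P (t ++ [z])) := by
  have hs := sum_nodeProb' L P t ht
  by_cases h0 : nodeProb L P t = 0
  · rw [h0] at hs
    have := (Finset.sum_eq_zero_iff_of_nonneg
      (fun z _ => nodeProb_nonneg' L P hPnn (t ++ [z]))).mp hs
    rw [Finset.sum_eq_zero (fun z hz => by rw [this z hz, zero_mul]), h0]
    simp
  · have h1 : nodeProb L P t * Real.logb 2 (nodeProb L P t) =
        ∑ z, nodeProb L P (t ++ [z]) * Real.logb 2 (nodeProb L P t) := by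
      rw [← Finset.sum_mul, hs]
    rw [h1, ← Finset.sum_sub_distrib]
    unfold ent branchDist
    rw [Finset.mul_sum]
    refine Finset.sum_congr rfl fun z _ => ?_
    by_cases hz : nodeProb L P (t ++ [z]) = 0
    · simp [hz]
    · rw [Real.logb_div hz h0]
      field_simp
      ring

/-- **Normalized Leaf Entropy Lemma.**
`H(P_Y)/E[ℓ(Y)] = Σ_{t ∈ B} P_B(t) H(P_{Y_t})`, where `P_B(t) = Q(t)/E[ℓ(Y)]`
and terms with `Q(t) = 0` are taken to be `0`. -/
theorem normalized_leaf_entropy_lemma {Z : Type*} [Fintype Z] [DecidableEq Z]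
    (L : Finset (List Z)) (hL : IsCompleteLeafSet L)
    (hZ : 2 ≤ Fintype.card Z)
    (P : List Z → ℝ) (hPnn : ∀ t ∈ L, 0 ≤ P t) (hPsum : ∑ t ∈ L, P t = 1) :
    ent L P / expLen L P =
      ∑ t ∈ branchSet L, (nodeProb L P t / expLen L P) *
        ent Finset.univ (branchDist L P t) := by
  obtain ⟨hne, hpf, -⟩ := hL
  have hBL : ∀ t ∈ branchSet L, t ∉ L := by
    intro t ht htL
    obtain ⟨s, hs, hp, hn⟩ := (mem_branchSet_iff' L t).mp ht
    exact hn (hpf t htL s hs hp)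
  have hdisj : Disjoint (branchSet L) L := Finset.disjoint_left.mpr hBL
  have hroot : [] ∈ branchSet L := by
    have hLn : L.Nonempty := by
      by_contra h
      rw [Finset.not_nonempty_iff_eq_empty] at h
      simp [h] at hPsum
    obtain ⟨s, hs⟩ := hLn
    exact (mem_branchSet_iff' L _).mpr ⟨s, hs, List.nil_prefix, (hne s hs).symm⟩
  have hQroot : nodeProb L P [] = 1 := by simp [nodeProb, hPsum]
  have hQL : ∀ s ∈ L, nodeProb L P s = P s := by
    intro s hs
    unfold nodeProb
    rw [Finset.sum_eq_single s]
    · intro b hb hbs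
      rw [Finset.mem_filter] at hb
      exact absurd (hpf s hs b hb.1 hb.2).symm hbs
    · intro h
      exact absurd (Finset.mem_filter.mpr ⟨hs, List.prefix_refl s⟩) h
  let F : List Z → ℝ := fun t => nodeProb L P t * Real.logb 2 (nodeProb L P t)
  have hF0 : ∀ u, u ∉ branchSet L ∪ L → F u = 0 := by
    intro u hu
    have : nodeProb L P u = 0 := by
      unfold nodeProb
      refine Finset.sum_eq_zero fun s hs => ?_
      rw [Finset.mem_filter] at hs
      exfalso
      apply hu
      rw [Finset.mem_union]
      by_cases h : u = s
      · right; rw [h]; exact hs.1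
      · left; exact (mem_branchSet_iff' L u).mpr ⟨s, hs.1, hs.2, h⟩
    simp [F, this]
  have hinj : Function.Injective (fun p : List Z × Z => p.1 ++ [p.2]) := by
    rintro ⟨a, b⟩ ⟨c, d⟩ h
    have := List.append_inj' h rfl
    simpa using this
  have hchild : ∑ t ∈ branchSet L, ∑ z, F (t ++ [z]) = ∑ u ∈ (branchSet L ∪ L).erase [], F u := by
    rw [← Finset.sum_product' (branchSet L) Finset.univ (fun t z => F (t ++ [z]))]
    rw [← Finset.sum_image (f := F) (g := fun p : List Z × Z => p.1 ++ [p.2]) hinj.injOn]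
    symm
    apply Finset.sum_subset
    · intro u hu
      rw [Finset.mem_erase, Finset.mem_union] at hu
      obtain ⟨hu0, hu⟩ := hu
      have hpre : ∃ s ∈ L, u <+: s := by
        rcases hu with hu | hu
        · obtain ⟨s, hs, hp, -⟩ := (mem_branchSet_iff' L u).mp hu
          exact ⟨s, hs, hp⟩
        · exact ⟨u, hu, List.prefix_refl u⟩
      obtain ⟨s, hs, hp⟩ := hpre
      have hlen : 0 < u.length := List.length_pos_iff.mpr hu0
      rw [Finset.mem_image]
      refine ⟨(u.dropLast, u.getLast hu0), ?_, List.dropLast_append_getLast hu0⟩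
      rw [Finset.mem_product]
      refine ⟨(mem_branchSet_iff' L _).mpr
        ⟨s, hs, (List.dropLast_prefix u).trans hp, fun h => ?_⟩, Finset.mem_univ _⟩
      have h1 := congrArg List.length h
      have h2 := hp.length_le
      rw [List.length_dropLast] at h1
      omega
    · intro u hu hu2
      apply hF0
      intro h
      apply hu2
      rw [Finset.mem_erase]
      refine ⟨?_, h⟩
      rw [Finset.mem_image] at hu
      obtain ⟨p, -, rfl⟩ := hu
      simp
  have hFroot : F [] = 0 := by simp [F, hQroot]
  have hmain : ent L P = ∑ t ∈ branchSet L, nodeProb L P t *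
      ent Finset.univ (branchDist L P t) := by
    rw [Finset.sum_congr rfl (fun t ht => node_term' L P hPnn t (hBL t ht)),
      Finset.sum_sub_distrib]
    change _ = ∑ t ∈ branchSet L, F t - ∑ t ∈ branchSet L, ∑ z, F (t ++ [z])
    rw [hchild, Finset.sum_erase _ hFroot, Finset.sum_union hdisj]
    have : ∑ s ∈ L, F s = ∑ s ∈ L, P s * Real.logb 2 (P s) :=
      Finset.sum_congr rfl fun s hs => by simp only [F, hQL s hs]
    rw [this]
    unfold ent
    rw [Finset.sum_neg_distrib]
    ring
  rw [hmain, Finset.sum_div]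
  exact Finset.sum_congr rfl fun t _ => by ring
end
end

section
/- (Entropy of the induced leaf distribution) Let L be a complete leaf set over a finite alphabet Z, let P_Z be a probability distribution on Z, and let P_Z^L be the induced leaf distribution on L. Then H(P_Z^L) = H(P_Z) · Σ_{t ∈ L} P_Z^L(t) ℓ(t); that is, the entropy of the parsed output equals the expected parse length times the per-letter entropy of the DMS, so the entropy rate H(P_Z^L)/E[ℓ] of P_Z^L equals H(P_Z). -/
open Finset

noncomputable section

/-- The subtree of `L` below the letter `z`. -/
def subLeaf {Z : Type*} (L : Finset (List Z)) (z : Z) : Finset (List Z) :=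
  L.preimage (fun t => z :: t) (fun _ _ _ _ h => (List.cons.inj h).2)

lemma mem_subLeaf {Z : Type*} (L : Finset (List Z)) (z : Z) (t : List Z) :
    t ∈ subLeaf L z ↔ z :: t ∈ L := by
  unfold subLeaf
  exact Finset.mem_preimage

lemma sum_subLeaf {Z : Type*} [Fintype Z] [DecidableEq Z] (L : Finset (List Z))
    (h : [] ∉ L) (f : List Z → ℝ) :
    ∑ t ∈ L, f t = ∑ z : Z, ∑ t ∈ subLeaf L z, f (z :: t) := by
  have hL : L = univ.biUnion (fun z : Z => (subLeaf L z).image (fun t => z :: t)) := by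
    ext t
    simp only [mem_biUnion, mem_univ, true_and, mem_image, mem_subLeaf]
    constructor
    · intro ht
      cases t with
      | nil => exact absurd ht h
      | cons z t => exact ⟨z, t, ht, rfl⟩
    · rintro ⟨z, t, ht, rfl⟩
      exact ht
  conv_lhs => rw [hL]
  rw [sum_biUnion]
  · refine sum_congr rfl fun z _ => ?_
    rw [sum_image]
    intro a _ b _ hab
    exact (List.cons.inj hab).2
  · intro a _ b _ hab
    simp only [Function.onFun]
    rw [Finset.disjoint_left]
    intro t ht ht'
    simp only [mem_image] at ht ht'
    obtain ⟨u, _, rfl⟩ := ht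
    obtain ⟨v, _, hv⟩ := ht'
    exact hab (List.cons.inj hv).1.symm

lemma mul_logb_mul (a b : ℝ) :
    -((a * b) * Real.logb 2 (a * b)) =
      a * -(b * Real.logb 2 b) + b * -(a * Real.logb 2 a) := by
  by_cases ha : a = 0
  · simp [ha]
  by_cases hb : b = 0
  · simp [hb]
  rw [Real.logb_mul ha hb]
  ring

lemma leaf_induction {Z : Type*} [Fintype Z] [DecidableEq Z]
    (PZ : Z → ℝ) (hZsum : ∑ z : Z, PZ z = 1) (N : ℕ) :
    ∀ L : Finset (List Z), (∀ s ∈ L, ∀ t ∈ L, s <+: t → s = t) →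
      (∀ s : List Z, N ≤ s.length → ∃ t, t ∈ L ∧ t <+: s) →
      ∑ t ∈ L, inducedProb PZ t = 1 ∧
      ent L (inducedProb PZ) = ent Finset.univ PZ * expLen L (inducedProb PZ) := by
  have base : ∀ L : Finset (List Z), (∀ s ∈ L, ∀ t ∈ L, s <+: t → s = t) → [] ∈ L →
      ∑ t ∈ L, inducedProb PZ t = 1 ∧
      ent L (inducedProb PZ) = ent Finset.univ PZ * expLen L (inducedProb PZ) := by
    intro L hp h
    have : L = {[]} := by
      ext t
      rw [mem_singleton]
      constructor
      · intro ht
        exact (hp [] h t ht List.nil_prefix).symm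
      · rintro rfl
        exact h
    subst this
    simp [ent, expLen, inducedProb]
  induction N with
  | zero =>
    intro L hp hc
    obtain ⟨t, ht, htp⟩ := hc [] (Nat.zero_le _)
    rw [List.prefix_nil] at htp
    subst htp
    exact base L hp ht
  | succ N ih =>
    intro L hp hc
    by_cases h : [] ∈ L
    · exact base L hp h
    have key : ∀ z, ∑ t ∈ subLeaf L z, inducedProb PZ t = 1 ∧
        ent (subLeaf L z) (inducedProb PZ) =
          ent Finset.univ PZ * expLen (subLeaf L z) (inducedProb PZ) := by
      intro z
      apply ih
      · intro s hs t ht hst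
        rw [mem_subLeaf] at hs ht
        exact (List.cons.inj (hp _ hs _ ht (by simpa using hst))).2
      · intro s hs
        obtain ⟨t, ht, htp⟩ := hc (z :: s) (by simpa using hs)
        cases t with
        | nil => exact absurd ht h
        | cons a t =>
          rw [List.cons_prefix_cons] at htp
          obtain ⟨rfl, htp⟩ := htp
          exact ⟨t, (mem_subLeaf _ _ _).2 ht, htp⟩
    have hcons : ∀ z t, inducedProb PZ (z :: t) = PZ z * inducedProb PZ t := by
      intro z t
      simp [inducedProb]
    have hexp : expLen L (inducedProb PZ) =
        ∑ z, PZ z * expLen (subLeaf L z) (inducedProb PZ) + 1 := by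
      rw [expLen, sum_subLeaf L h, ← hZsum, ← sum_add_distrib]
      refine sum_congr rfl fun z _ => ?_
      have h1 : PZ z = PZ z * ∑ t ∈ subLeaf L z, inducedProb PZ t := by
        rw [(key z).1, mul_one]
      rw [expLen]
      conv_rhs => rw [add_comm]; enter [1]; rw [h1]
      rw [← mul_add, ← sum_add_distrib, mul_sum]
      refine sum_congr rfl fun t _ => ?_
      rw [hcons, List.length_cons]
      push_cast
      ring
    constructor
    · rw [sum_subLeaf L h, ← hZsum]
      refine sum_congr rfl fun z _ => ?_
      simp only [hcons]
      rw [← mul_sum, (key z).1, mul_one]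
    · have hent : ent L (inducedProb PZ) =
          ∑ z, PZ z * ent (subLeaf L z) (inducedProb PZ) + ent univ PZ := by
        rw [ent, sum_subLeaf L h]
        conv_rhs => enter [2]; rw [ent]
        rw [← sum_add_distrib]
        refine sum_congr rfl fun z _ => ?_
        simp only [hcons, mul_logb_mul]
        rw [sum_add_distrib, ← mul_sum, ← sum_mul, (key z).1, one_mul, ent]
      rw [hent, hexp, mul_add, mul_one, mul_sum]
      congr 1
      refine sum_congr rfl fun z _ => ?_
      rw [(key z).2]
      ring

/-- **Entropy of the induced leaf distribution.**
`H(P_Z^L) = H(P_Z) · Σ_{t ∈ L} P_Z^L(t) ℓ(t)`; equivalently the entropy rate of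
`P_Z^L` equals `H(P_Z)`. -/
theorem entropy_induced_leaf_distribution {Z : Type*} [Fintype Z] [DecidableEq Z]
    (L : Finset (List Z)) (hL : IsCompleteLeafSet L)
    (hZ : 2 ≤ Fintype.card Z)
    (PZ : Z → ℝ) (hZnn : ∀ z : Z, 0 ≤ PZ z) (hZsum : ∑ z : Z, PZ z = 1) :
    ent L (inducedProb PZ) =
      ent Finset.univ PZ * ∑ t ∈ L, inducedProb PZ t * t.length ∧
    ent L (inducedProb PZ) / expLen L (inducedProb PZ) = ent Finset.univ PZ := by
  obtain ⟨hne, hp, N, hN⟩ := hL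
  obtain ⟨h1, h2⟩ := leaf_induction PZ hZsum N L hp (fun s hs => (hN s hs).exists)
  have hpos : 1 ≤ expLen L (inducedProb PZ) := by
    rw [← h1, expLen]
    refine sum_le_sum fun t ht => ?_
    have hnn : 0 ≤ inducedProb PZ t := by
      refine List.prod_nonneg fun a ha => ?_
      obtain ⟨z, _, rfl⟩ := List.mem_map.1 ha
      exact hZnn z
    have hlen : (1 : ℝ) ≤ t.length := by
      exact_mod_cast List.length_pos_of_ne_nil (hne t ht)
    exact le_mul_of_one_le_right hnn hlen
  refine ⟨h2, ?_⟩
  rw [h2, mul_div_assoc, div_self (by linarith), mul_one]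
end
end

section
/- (Entropy rate continuity on trees) Let L be a complete leaf set over a finite alphabet Z with m := |Z| ≥ 2, branching set B; let P_Y be a probability distribution on L with node probabilities Q, branching distributions P_{Y_t}, and P_B(t) := Q(t)/E[ℓ(Y)]; and let P_Z be a probability distribution on Z. For 0 < ε ≤ 1/2 define θ(ε) := (ε² / log₂ m) · log₂(m/(e·ε)) and σ(ε) := ε · log₂(m²/(e·ε²)). If Σ_{t ∈ B} P_B(t) ‖P_{Y_t} − P_Z‖₁ ≤ θ(ε), then |H(P_Y)/E[ℓ(Y)] − H(P_Z)| ≤ σ(ε). -/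
open Finset

noncomputable section

/-! ### Analytic lemmas -/

lemma erc_log_le {d : ℝ} (h0 : 0 < d) (h : d ≤ 1 / 4) : Real.log d ≤ -1 := by
  have h1 := Real.log_le_log h0 h
  have h2 : Real.log (1 / 4 : ℝ) = -(2 * Real.log 2) := by
    rw [show (1 / 4 : ℝ) = ((2 : ℝ) ^ 2)⁻¹ by norm_num, Real.log_inv, Real.log_pow]
    norm_num
  have h3 := Real.log_two_gt_d9
  linarith

lemma erc_le_negMulLog {d : ℝ} (h0 : 0 ≤ d) (h : d ≤ 1 / 4) : d ≤ Real.negMulLog d := by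
  rcases h0.eq_or_lt with rfl | h0
  · simp
  · have := erc_log_le h0 h
    unfold Real.negMulLog
    nlinarith

lemma erc_negMulLog_mono {a b : ℝ} (h0 : 0 ≤ a) (hab : a ≤ b) (h : b ≤ 1 / 4) :
    Real.negMulLog a ≤ Real.negMulLog b := by
  rcases h0.eq_or_lt with rfl | h0
  · simpa using hab.trans (erc_le_negMulLog hab h)
  · have hb : 0 < b := h0.trans_le hab
    have h1 := erc_log_le hb h
    have h2 := Real.log_le_sub_one_of_pos (div_pos hb h0)
    rw [Real.log_div hb.ne' h0.ne'] at h2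
    have h3 := mul_le_mul_of_nonneg_left h2 h0.le
    have h4 : a * (b / a - 1) = b - a := by field_simp
    rw [h4] at h3
    unfold Real.negMulLog
    nlinarith

lemma erc_diff_aux {x y : ℝ} (hx : 0 ≤ x) (hxy : x ≤ y) (hy : y ≤ 1) (hd : y - x ≤ 1 / 4) :
    |Real.negMulLog y - Real.negMulLog x| ≤ Real.negMulLog (y - x) := by
  rcases hx.eq_or_lt with rfl | hx
  · simp [abs_of_nonneg (Real.negMulLog_nonneg hxy hy)]
  rcases hxy.eq_or_lt with rfl | hlt
  · simp
  have hy0 : 0 < y := hx.trans hlt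
  have hd0 : 0 < y - x := by linarith
  rw [abs_le]
  constructor
  · have h0 := erc_le_negMulLog hd0.le hd
    have h2 := Real.log_le_sub_one_of_pos (div_pos hy0 hx)
    rw [Real.log_div hy0.ne' hx.ne'] at h2
    have h3 := mul_le_mul_of_nonneg_left h2 hx.le
    have h4 : x * (y / x - 1) = y - x := by field_simp
    rw [h4] at h3
    have h5 := Real.log_nonpos hy0.le hy
    have h6 : Real.negMulLog x - Real.negMulLog y ≤ y - x := by
      unfold Real.negMulLog
      nlinarith
    linarith
  · have h1 := Real.log_le_log hx hlt.le
    have h2 := Real.log_le_log hd0 (show y - x ≤ y by linarith)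
    unfold Real.negMulLog
    nlinarith

lemma erc_diff {x y : ℝ} (hx : 0 ≤ x) (hx1 : x ≤ 1) (hy : 0 ≤ y) (hy1 : y ≤ 1)
    (hd : |x - y| ≤ 1 / 4) :
    |Real.negMulLog x - Real.negMulLog y| ≤ Real.negMulLog |x - y| := by
  rcases le_total x y with h | h
  · rw [abs_sub_comm x y, abs_of_nonneg (sub_nonneg.2 h)] at *
    rw [abs_sub_comm]
    exact erc_diff_aux hx h hy1 hd
  · rw [abs_of_nonneg (sub_nonneg.2 h)] at *
    exact erc_diff_aux hy h hx1 hd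

section
variable {Z : Type*} [Fintype Z]

lemma erc_jensen (hm : 0 < Fintype.card Z) (p : Z → ℝ) (hp : ∀ z, 0 ≤ p z) :
    ∑ z, Real.negMulLog (p z) ≤
      Fintype.card Z * Real.negMulLog ((∑ z, p z) / Fintype.card Z) := by
  have hm' : (0 : ℝ) < Fintype.card Z := by exact_mod_cast hm
  have h := Real.concaveOn_negMulLog.le_map_sum (t := Finset.univ)
    (w := fun _ : Z => (Fintype.card Z : ℝ)⁻¹) (p := p) (fun _ _ => by positivity)
    (by simp [hm'.ne']) (fun z _ => hp z)
  simp only [smul_eq_mul, ← Finset.mul_sum] at h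
  rw [inv_mul_le_iff₀ hm'] at h
  rwa [div_eq_inv_mul]

lemma erc_ent_eq {α : Type*} (S : Finset α) (P : α → ℝ) :
    ent S P = (∑ x ∈ S, Real.negMulLog (P x)) / Real.log 2 := by
  unfold ent
  rw [Finset.sum_div]
  refine Finset.sum_congr rfl fun x _ => ?_
  simp only [Real.negMulLog, Real.logb]
  ring

lemma erc_le_one {p : Z → ℝ} (hp : ∀ z, 0 ≤ p z) (hs : ∑ z, p z = 1) (z : Z) : p z ≤ 1 :=
  hs ▸ Finset.single_le_sum (fun z _ => hp z) (Finset.mem_univ z)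

lemma erc_H_nonneg {p : Z → ℝ} (hp : ∀ z, 0 ≤ p z) (hs : ∑ z, p z = 1) :
    0 ≤ ∑ z, Real.negMulLog (p z) :=
  Finset.sum_nonneg fun z _ => Real.negMulLog_nonneg (hp z) (erc_le_one hp hs z)

lemma erc_H_le (hm : 0 < Fintype.card Z) {p : Z → ℝ} (hp : ∀ z, 0 ≤ p z) (hs : ∑ z, p z = 1) :
    ∑ z, Real.negMulLog (p z) ≤ Real.log (Fintype.card Z) := by
  refine (erc_jensen hm p hp).trans ?_
  have hm' : (0 : ℝ) < Fintype.card Z := by exact_mod_cast hm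
  rw [hs, Real.negMulLog, one_div, Real.log_inv]
  field_simp
  exact le_rfl

lemma erc_half [DecidableEq Z] {p q : Z → ℝ} (hp : ∑ z, p z = 1) (hq : ∑ z, q z = 1) (z : Z) :
    2 * |p z - q z| ≤ l1dist p q := by
  unfold l1dist
  rw [← Finset.add_sum_erase _ _ (Finset.mem_univ z)]
  have h1 : ∑ z, (p z - q z) = 0 := by rw [Finset.sum_sub_distrib, hp, hq, sub_self]
  rw [← Finset.add_sum_erase _ _ (Finset.mem_univ z)] at h1
  have h2 : p z - q z = -∑ z ∈ Finset.univ.erase z, (p z - q z) := by linarith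
  have h3 : |p z - q z| ≤ ∑ z ∈ Finset.univ.erase z, |p z - q z| := by
    rw [h2, abs_neg]
    exact Finset.abs_sum_le_sum_abs _ _
  linarith

/-- Pointwise bound, in nats. -/
lemma erc_pointwise [DecidableEq Z] (hm : 2 ≤ Fintype.card Z) {p q : Z → ℝ}
    (hp0 : ∀ z, 0 ≤ p z) (hp : ∑ z, p z = 1) (hq0 : ∀ z, 0 ≤ q z) (hq : ∑ z, q z = 1)
    {ε : ℝ} (hε0 : 0 < ε) (hε : ε ≤ 1 / 2) :
    |∑ z, Real.negMulLog (p z) - ∑ z, Real.negMulLog (q z)| ≤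
      ε * (Real.log (Fintype.card Z) - Real.log ε) +
        l1dist p q / ε * Real.log (Fintype.card Z) := by
  have hm0 : 0 < Fintype.card Z := by omega
  have hm2 : (2 : ℝ) ≤ Fintype.card Z := by exact_mod_cast hm
  have hm' : (0 : ℝ) < Fintype.card Z := by linarith
  have hlm : 0 ≤ Real.log (Fintype.card Z) := Real.log_nonneg (by linarith)
  have hle : Real.log ε ≤ 0 := Real.log_nonpos hε0.le (by linarith)
  have hl0 : 0 ≤ l1dist p q := Finset.sum_nonneg fun _ _ => abs_nonneg _
  rcases le_total (l1dist p q) ε with h | h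
  · have h1 : |∑ z, Real.negMulLog (p z) - ∑ z, Real.negMulLog (q z)| ≤
        ∑ z, Real.negMulLog |p z - q z| := by
      rw [← Finset.sum_sub_distrib]
      refine (Finset.abs_sum_le_sum_abs _ _).trans (Finset.sum_le_sum fun z _ => ?_)
      refine erc_diff (hp0 z) (erc_le_one hp0 hp z) (hq0 z) (erc_le_one hq0 hq z) ?_
      have := erc_half hp hq z
      linarith
    have h2 := erc_jensen hm0 (fun z => |p z - q z|) (fun _ => abs_nonneg _)
    have h3 : Real.negMulLog ((∑ z, |p z - q z|) / Fintype.card Z) ≤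
        Real.negMulLog (ε / Fintype.card Z) := by
      refine erc_negMulLog_mono (by positivity) (by gcongr; exact h) ?_
      rw [div_le_iff₀ hm']
      linarith
    have h4 := mul_le_mul_of_nonneg_left h3 hm'.le
    have h5 : (Fintype.card Z : ℝ) * Real.negMulLog (ε / Fintype.card Z) =
        ε * (Real.log (Fintype.card Z) - Real.log ε) := by
      rw [Real.negMulLog, Real.log_div hε0.ne' hm'.ne']
      field_simp
      ring
    have h6 : 0 ≤ l1dist p q / ε * Real.log (Fintype.card Z) := by positivity
    linarith
  · have h1 : 1 ≤ l1dist p q / ε := by rwa [one_le_div hε0]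
    have h2 : Real.log (Fintype.card Z) ≤ l1dist p q / ε * Real.log (Fintype.card Z) :=
      le_mul_of_one_le_left hlm h1
    have h3 : 0 ≤ ε * (Real.log (Fintype.card Z) - Real.log ε) :=
      mul_nonneg hε0.le (by linarith)
    have a1 := erc_H_nonneg hp0 hp
    have a2 := erc_H_nonneg hq0 hq
    have a3 := erc_H_le hm0 hp0 hp
    have a4 := erc_H_le hm0 hq0 hq
    rw [abs_le]
    constructor <;> linarith

end

/-! ### Tree lemmas -/

section
variable {Z : Type*} [DecidableEq Z]

lemma erc_mem_branch {L : Finset (List Z)} {t : List Z} :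
    t ∈ branchSet L ↔ ∃ s ∈ L, t <+: s ∧ t.length < s.length := by
  simp only [branchSet, Finset.mem_biUnion, Finset.mem_image, Finset.mem_range]
  constructor
  · rintro ⟨s, hs, i, hi, rfl⟩
    exact ⟨s, hs, List.take_prefix _ _, by simp [hi]⟩
  · rintro ⟨s, hs, h1, h2⟩
    exact ⟨s, hs, t.length, h2, (List.prefix_iff_eq_take.1 h1).symm⟩

lemma erc_not_leaf {L : Finset (List Z)} (hL : IsCompleteLeafSet L) {t : List Z}
    (ht : t ∈ branchSet L) : t ∉ L := by
  intro h
  obtain ⟨s, hs, h1, h2⟩ := erc_mem_branch.1 ht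
  have := hL.2.1 t h s hs h1
  subst this
  exact lt_irrefl _ h2

lemma erc_child {L : Finset (List Z)} (hL : IsCompleteLeafSet L) {t : List Z}
    (ht : t ∈ branchSet L) (z : Z) : t ++ [z] ∈ branchSet L ∨ t ++ [z] ∈ L := by
  obtain ⟨N, hN⟩ := hL.2.2
  obtain ⟨u, ⟨hu, hpre⟩, -⟩ := hN (t ++ [z] ++ List.replicate N z) (by simp; omega)
  rcases List.prefix_or_prefix_of_prefix hpre (List.prefix_append (t ++ [z]) _) with h | h
  · rcases List.prefix_concat_iff.1 h with h' | h'
    · right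
      rwa [← h']
    · exfalso
      obtain ⟨s, hs, h1, h2⟩ := erc_mem_branch.1 ht
      have := hL.2.1 u hu s hs (h'.trans h1)
      subst this
      have := h'.length_le
      omega
  · rcases h.length_le.eq_or_lt with h' | h'
    · right
      rwa [h.eq_of_length h']
    · left
      exact erc_mem_branch.2 ⟨u, hu, h, h'⟩

lemma erc_nil_mem {L : Finset (List Z)} (hL : IsCompleteLeafSet L) (hne : L.Nonempty) :
    [] ∈ branchSet L := by
  obtain ⟨s, hs⟩ := hne
  exact erc_mem_branch.2 ⟨s, hs, List.nil_prefix, List.length_pos_iff.2 (hL.1 s hs)⟩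

/-- Leaf-node lemma. -/
lemma erc_leaf_node [Fintype Z] {L : Finset (List Z)} (hL : IsCompleteLeafSet L)
    (hne : L.Nonempty) (G : List Z → ℝ) :
    ∑ t ∈ branchSet L, (∑ z, G (t ++ [z]) - G t) = ∑ s ∈ L, G s - G [] := by
  have hdisj : Disjoint (branchSet L) L :=
    Finset.disjoint_left.2 fun t ht => erc_not_leaf hL ht
  have hnil : [] ∈ branchSet L ∪ L := Finset.mem_union_left _ (erc_nil_mem hL hne)
  have key : ∑ t ∈ branchSet L, ∑ z, G (t ++ [z]) = ∑ s ∈ (branchSet L ∪ L).erase [], G s := by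
    rw [← Finset.sum_product']
    refine Finset.sum_bij (fun x _ => x.1 ++ [x.2]) ?_ ?_ ?_ ?_
    · rintro ⟨t, z⟩ h
      have ht := (Finset.mem_product.1 h).1
      refine Finset.mem_erase.2 ⟨by simp, Finset.mem_union.2 (erc_child hL ht z)⟩
    · rintro ⟨t, z⟩ _ ⟨t', z'⟩ _ h
      have := List.append_inj' h rfl
      simpa using this
    · intro s hs
      obtain ⟨hs0, hs1⟩ := Finset.mem_erase.1 hs
      refine ⟨(s.dropLast, s.getLast hs0), ?_, List.dropLast_append_getLast hs0⟩
      refine Finset.mem_product.2 ⟨?_, Finset.mem_univ _⟩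
      have hlen : s.dropLast.length < s.length := by
        have := List.length_pos_iff.2 hs0
        simp only [List.length_dropLast]
        omega
      rcases Finset.mem_union.1 hs1 with h | h
      · obtain ⟨u, hu, h1, h2⟩ := erc_mem_branch.1 h
        exact erc_mem_branch.2 ⟨u, hu, (List.dropLast_prefix s).trans h1, hlen.trans h2⟩
      · exact erc_mem_branch.2 ⟨s, h, List.dropLast_prefix s, hlen⟩
    · intros
      rfl
  have h2 := Finset.add_sum_erase _ G hnil
  rw [Finset.sum_union hdisj] at h2
  rw [Finset.sum_sub_distrib, key]
  linarith

lemma erc_Q_nil (L : Finset (List Z)) (P : List Z → ℝ) :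
    nodeProb L P [] = ∑ s ∈ L, P s := by
  simp [nodeProb]

lemma erc_Q_leaf {L : Finset (List Z)} (hL : IsCompleteLeafSet L) (P : List Z → ℝ)
    {s : List Z} (hs : s ∈ L) : nodeProb L P s = P s := by
  have : L.filter (fun u => s <+: u) = {s} := by
    ext u
    simp only [Finset.mem_filter, Finset.mem_singleton]
    constructor
    · rintro ⟨hu, h⟩
      exact (hL.2.1 s hs u hu h).symm
    · rintro rfl
      exact ⟨hs, List.prefix_rfl⟩
  simp [nodeProb, this]

lemma erc_Q_nonneg {L : Finset (List Z)} {P : List Z → ℝ} (hP : ∀ t ∈ L, 0 ≤ P t)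
    (t : List Z) : 0 ≤ nodeProb L P t :=
  Finset.sum_nonneg fun s hs => hP s (Finset.mem_filter.1 hs).1

lemma erc_Q_sum [Fintype Z] {L : Finset (List Z)} (hL : IsCompleteLeafSet L) (P : List Z → ℝ)
    {t : List Z} (ht : t ∈ branchSet L) :
    ∑ z, nodeProb L P (t ++ [z]) = nodeProb L P t := by
  unfold nodeProb
  rw [← Finset.sum_biUnion]
  · refine Finset.sum_congr ?_ fun _ _ => rfl
    ext u
    simp only [Finset.mem_biUnion, Finset.mem_univ, true_and, Finset.mem_filter]
    constructor
    · rintro ⟨z, hu, h⟩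
      exact ⟨hu, (List.prefix_append t [z]).trans h⟩
    · rintro ⟨hu, r, rfl⟩
      cases r with
      | nil => exact absurd (by simpa using hu) (erc_not_leaf hL ht)
      | cons z r => exact ⟨z, hu, r, by simp⟩
  · intro z _ z' _ hne
    refine Finset.disjoint_left.2 fun u h1 h2 => hne ?_
    have a1 := (Finset.mem_filter.1 h1).2
    have a2 := (Finset.mem_filter.1 h2).2
    have h3 := List.prefix_of_prefix_length_le a1 a2 (by simp)
    simpa using h3

/-- The node probabilities of the branching nodes sum to the expected leaf length. -/
lemma erc_sum_Q [Fintype Z] {L : Finset (List Z)} (hL : IsCompleteLeafSet L)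
    (hne : L.Nonempty) (P : List Z → ℝ) :
    ∑ t ∈ branchSet L, nodeProb L P t = expLen L P := by
  have h := erc_leaf_node hL hne (fun t => nodeProb L P t * t.length)
  have h1 : ∑ s ∈ L, nodeProb L P s * s.length = expLen L P :=
    Finset.sum_congr rfl fun s hs => by rw [erc_Q_leaf hL P hs]
  simp only [h1, List.length_nil, Nat.cast_zero, mul_zero, sub_zero] at h
  rw [← h]
  refine Finset.sum_congr rfl fun t ht => ?_
  simp only [List.length_append, List.length_singleton]
  rw [← Finset.sum_mul, erc_Q_sum hL P ht]
  push_cast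
  ring

/-- Chain rule for the entropy of leaves (in nats). -/
lemma erc_chain [Fintype Z] {L : Finset (List Z)} (hL : IsCompleteLeafSet L)
    (hne : L.Nonempty) {P : List Z → ℝ} (hP : ∀ t ∈ L, 0 ≤ P t) (hs : ∑ t ∈ L, P t = 1) :
    ∑ t ∈ branchSet L, nodeProb L P t * ∑ z, Real.negMulLog (branchDist L P t z) =
      ∑ s ∈ L, Real.negMulLog (P s) := by
  have h := erc_leaf_node hL hne (fun t => Real.negMulLog (nodeProb L P t))
  have h1 : ∑ s ∈ L, Real.negMulLog (nodeProb L P s) = ∑ s ∈ L, Real.negMulLog (P s) :=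
    Finset.sum_congr rfl fun s hs => by rw [erc_Q_leaf hL P hs]
  rw [h1, erc_Q_nil, hs, Real.negMulLog_one, sub_zero] at h
  rw [← h]
  refine Finset.sum_congr rfl fun t ht => ?_
  have hsum := erc_Q_sum hL P ht
  rcases (erc_Q_nonneg hP t).eq_or_lt with h0 | h0
  · rw [← h0] at hsum
    have hz := (Finset.sum_eq_zero_iff_of_nonneg
      (fun z _ => erc_Q_nonneg hP (t ++ [z]))).1 hsum
    simp only [← h0, zero_mul, Real.negMulLog_zero, sub_zero]
    exact (Finset.sum_eq_zero fun z hz' => by rw [hz z hz', Real.negMulLog_zero]).symm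
  · have hb : ∀ z, nodeProb L P (t ++ [z]) = nodeProb L P t * branchDist L P t z := fun z => by
      unfold branchDist
      field_simp
    have hb1 : ∑ z, branchDist L P t z = 1 := by
      simp only [hb, ← Finset.mul_sum] at hsum
      exact mul_left_cancel₀ h0.ne' (by rw [hsum, mul_one])
    simp only [hb, Real.negMulLog_mul, Finset.sum_add_distrib, ← Finset.mul_sum,
      ← Finset.sum_mul, hb1]
    ring

end

/-- **Entropy rate continuity on trees.** With `m = |Z| ≥ 2`,
`θ(ε) = (ε²/log₂ m) log₂(m/(eε))` and `σ(ε) = ε log₂(m²/(eε²))` for `0 < ε ≤ 1/2`: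
if `Σ_{t ∈ B} P_B(t) ‖P_{Y_t} − P_Z‖₁ ≤ θ(ε)` then
`|H(P_Y)/E[ℓ(Y)] − H(P_Z)| ≤ σ(ε)`. -/
theorem entropy_rate_continuity {Z : Type*} [Fintype Z] [DecidableEq Z]
    (L : Finset (List Z)) (hL : IsCompleteLeafSet L)
    (hZ : 2 ≤ Fintype.card Z)
    (P : List Z → ℝ) (hPnn : ∀ t ∈ L, 0 ≤ P t) (hPsum : ∑ t ∈ L, P t = 1)
    (PZ : Z → ℝ) (hZnn : ∀ z : Z, 0 ≤ PZ z) (hZsum : ∑ z : Z, PZ z = 1)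
    (ε : ℝ) (hε0 : 0 < ε) (hε : ε ≤ 1 / 2)
    (havg : ∑ t ∈ branchSet L, (nodeProb L P t / expLen L P) *
        l1dist (branchDist L P t) PZ ≤
      ε ^ 2 / Real.logb 2 (Fintype.card Z) *
        Real.logb 2 (Fintype.card Z / (Real.exp 1 * ε))) :
    |ent L P / expLen L P - ent Finset.univ PZ| ≤
      ε * Real.logb 2 ((Fintype.card Z : ℝ) ^ 2 / (Real.exp 1 * ε ^ 2)) := by
  have hne : L.Nonempty := by
    rw [Finset.nonempty_iff_ne_empty]
    rintro rfl
    simp at hPsum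
  have hm2 : (2 : ℝ) ≤ Fintype.card Z := by exact_mod_cast hZ
  have hm' : (0 : ℝ) < Fintype.card Z := by linarith
  have hl2 : 0 < Real.log 2 := Real.log_pos (by norm_num)
  have hlm : 0 < Real.log (Fintype.card Z) := Real.log_pos (by linarith)
  have hE : 0 < expLen L P := by
    have : ∑ t ∈ L, P t ≤ expLen L P := by
      refine Finset.sum_le_sum fun t ht => ?_
      refine le_mul_of_one_le_right (hPnn t ht) ?_
      exact_mod_cast List.length_pos_iff.2 (hL.1 t ht)
    linarith
  have hsumQ := erc_sum_Q hL hne P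
  have hchain := erc_chain hL hne hPnn hPsum
  set m : ℝ := (Fintype.card Z : ℝ) with hm
  set E := expLen L P with hEdef
  set HZ := ∑ z, Real.negMulLog (PZ z) with hHZ
  set A := ε * (Real.log m - Real.log ε) with hA
  set D := ∑ t ∈ branchSet L, nodeProb L P t / E * l1dist (branchDist L P t) PZ with hD
  have hw : ∑ t ∈ branchSet L, nodeProb L P t / E = 1 := by
    rw [← Finset.sum_div, hsumQ, div_self hE.ne']
  have hrate : (∑ s ∈ L, Real.negMulLog (P s)) / E - HZ =
      ∑ t ∈ branchSet L, nodeProb L P t / E *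
        (∑ z, Real.negMulLog (branchDist L P t z) - HZ) := by
    simp only [mul_sub, Finset.sum_sub_distrib, ← Finset.sum_mul, hw, one_mul]
    rw [← hchain, Finset.sum_div]
    congr 1
    exact Finset.sum_congr rfl fun t _ => by ring
  have hnats : |(∑ s ∈ L, Real.negMulLog (P s)) / E - HZ| ≤ A + D / ε * Real.log m := by
    rw [hrate]
    refine (Finset.abs_sum_le_sum_abs _ _).trans ?_
    have hterm : ∀ t ∈ branchSet L, |nodeProb L P t / E *
        (∑ z, Real.negMulLog (branchDist L P t z) - HZ)| ≤
        nodeProb L P t / E * (A + l1dist (branchDist L P t) PZ / ε * Real.log m) := by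
      intro t ht
      have hQ := erc_Q_nonneg hPnn t
      rw [abs_mul, abs_of_nonneg (div_nonneg hQ hE.le)]
      rcases hQ.eq_or_lt with h0 | h0
      · simp [← h0]
      · refine mul_le_mul_of_nonneg_left ?_ (div_nonneg hQ hE.le)
        refine erc_pointwise hZ (fun z => div_nonneg (erc_Q_nonneg hPnn _) hQ) ?_ hZnn hZsum
          hε0 hε
        rw [← Finset.sum_div, erc_Q_sum hL P ht, div_self h0.ne']
    refine (Finset.sum_le_sum hterm).trans (le_of_eq ?_)
    simp only [mul_add, Finset.sum_add_distrib, ← Finset.sum_mul, hw, one_mul]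
    rw [hD, Finset.sum_div, Finset.sum_mul]
    congr 1
    exact Finset.sum_congr rfl fun t _ => by ring
  have hDle : D / ε * Real.log m ≤ ε * (Real.log m - 1 - Real.log ε) := by
    have hθ : ε ^ 2 / Real.logb 2 m * Real.logb 2 (m / (Real.exp 1 * ε)) =
        ε ^ 2 * (Real.log m - 1 - Real.log ε) / Real.log m := by
      rw [Real.logb, Real.logb, Real.log_div hm'.ne' (by positivity),
        Real.log_mul (Real.exp_pos 1).ne' hε0.ne', Real.log_exp]
      field_simp
      ring
    rw [hθ, le_div_iff₀ hlm] at havg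
    rw [div_mul_eq_mul_div, div_le_iff₀ hε0]
    linarith
  rw [erc_ent_eq, erc_ent_eq]
  have e1 : (∑ x ∈ L, Real.negMulLog (P x)) / Real.log 2 / E - HZ / Real.log 2 =
      ((∑ s ∈ L, Real.negMulLog (P s)) / E - HZ) / Real.log 2 := by
    field_simp
  rw [e1, abs_div, abs_of_pos hl2, div_le_iff₀ hl2]
  have e2 : ε * Real.logb 2 (m ^ 2 / (Real.exp 1 * ε ^ 2)) * Real.log 2 =
      A + ε * (Real.log m - 1 - Real.log ε) := by
    rw [Real.logb, Real.log_div (by positivity) (by positivity),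
      Real.log_mul (Real.exp_pos 1).ne' (by positivity), Real.log_exp, Real.log_pow,
      Real.log_pow, hA]
    field_simp
    push_cast
    ring
  rw [e2]
  linarith
end
end

section
/- (Normalized divergence controls entropy rate) Let L be a complete leaf set over a finite alphabet Z with m := |Z| ≥ 2, let P_Z be a probability distribution on Z with P_Z(z) > 0 for all z ∈ Z and induced leaf distribution P_Z^L, and let P_Y be a probability distribution on L. For 0 < ε ≤ 1/2 define θ(ε) := (ε² / log₂ m) · log₂(m/(e·ε)) and σ(ε) := ε · log₂(m²/(e·ε²)). If D(P_Y ‖ P_Z^L)/E[ℓ(Y)] ≤ θ(ε)²/(2 ln 2), then |H(P_Y)/E[ℓ(Y)] − H(P_Z)| ≤ σ(ε). (In particular, as the normalized divergence tends to 0, the entropy rate of P_Y tends to H(P_Z).) -/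
open Finset

noncomputable section

/-- One-variable inequality behind Pinsker. -/
theorem aux_log_ge {x : ℝ} (hx : 1 ≤ x) : 2 * (x - 1) ≤ (x + 1) * Real.log x := by
  have h := Real.le_log_one_add_of_nonneg (x := x - 1) (by linarith)
  rw [div_le_iff₀ (by linarith)] at h
  have e : 1 + (x - 1) = x := by ring
  rw [e] at h
  linarith

theorem aux_log_le {x : ℝ} (h0 : 0 < x) (hx : x ≤ 1) : (x + 1) * Real.log x ≤ 2 * (x - 1) := by
  have h := aux_log_ge (x := x⁻¹) ((one_le_inv₀ h0).2 hx)
  rw [Real.log_inv] at h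
  have h2 := mul_le_mul_of_nonneg_left h h0.le
  have e1 : x * (2 * (x⁻¹ - 1)) = 2 * (1 - x) := by field_simp
  have e2 : x * ((x⁻¹ + 1) * -Real.log x) = - ((x + 1) * Real.log x) := by field_simp; ring
  rw [e1, e2] at h2
  linarith

def auxK (x : ℝ) : ℝ := (2 * x + 4) * (x * Real.log x - x + 1) - 3 * (x - 1) ^ 2

theorem auxK_deriv {x : ℝ} (hx : 0 < x) :
    HasDerivAt auxK (4 * ((x + 1) * Real.log x - 2 * (x - 1))) x := by
  have h1 : HasDerivAt (fun x : ℝ => x) 1 x := hasDerivAt_id x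
  have h2 := (((h1.const_mul 2).add_const 4).mul
    (((h1.mul (Real.hasDerivAt_log hx.ne')).sub h1).add_const 1)).sub
    (((h1.sub_const 1).pow 2).const_mul 3)
  refine h2.congr_deriv ?_
  simp
  field_simp
  ring

theorem auxK_nonneg {x : ℝ} (hx : 0 < x) : 0 ≤ auxK x := by
  have h1 : auxK 1 = 0 := by simp [auxK]
  rcases le_total x 1 with h | h
  · have : AntitoneOn auxK (Set.Icc x 1) := by
      apply antitoneOn_of_deriv_nonpos (convex_Icc _ _)
      · intro y hy
        exact (auxK_deriv (lt_of_lt_of_le hx hy.1)).continuousAt.continuousWithinAt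
      · intro y hy
        rw [interior_Icc] at hy
        exact (auxK_deriv (hx.trans hy.1)).differentiableAt.differentiableWithinAt
      · intro y hy
        rw [interior_Icc] at hy
        rw [(auxK_deriv (hx.trans hy.1)).deriv]
        linarith [aux_log_le (hx.trans hy.1) hy.2.le]
    have := this (Set.left_mem_Icc.2 h) (Set.right_mem_Icc.2 h) h
    linarith
  · have : MonotoneOn auxK (Set.Icc 1 x) := by
      apply monotoneOn_of_deriv_nonneg (convex_Icc _ _)
      · intro y hy
        exact (auxK_deriv (lt_of_lt_of_le one_pos hy.1)).continuousAt.continuousWithinAt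
      · intro y hy
        rw [interior_Icc] at hy
        exact (auxK_deriv (one_pos.trans hy.1)).differentiableAt.differentiableWithinAt
      · intro y hy
        rw [interior_Icc] at hy
        rw [(auxK_deriv (one_pos.trans hy.1)).deriv]
        linarith [aux_log_ge hy.1.le]
    have := this (Set.left_mem_Icc.2 h) (Set.right_mem_Icc.2 h) h
    linarith

theorem pinsker_term {f q : ℝ} (hf : 0 ≤ f) (hq : 0 < q) :
    |f - q| ^ 2 / (2 * f + 4 * q) ≤ (f * (Real.log f - Real.log q) - f + q) / 3 := by
  rw [div_le_div_iff₀ (by positivity) (by norm_num), sq_abs]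
  rcases hf.eq_or_lt with h | h
  · subst h; simp; nlinarith
  · have := auxK_nonneg (div_pos h hq)
    unfold auxK at this
    rw [Real.log_div h.ne' hq.ne'] at this
    have h2 := mul_nonneg this (sq_nonneg q)
    have e : ((2 * (f / q) + 4) * (f / q * (Real.log f - Real.log q) - f / q + 1) -
      3 * (f / q - 1) ^ 2) * q ^ 2 = (2 * f + 4 * q) * (f * (Real.log f - Real.log q) - f + q)
        - 3 * (f - q) ^ 2 := by field_simp
    rw [e] at h2
    linarith

theorem pinsker {Z : Type*} [Fintype Z] (f q : Z → ℝ) (hf : ∀ z, 0 ≤ f z) (hq : ∀ z, 0 < q z)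
    (sf : ∑ z, f z = 1) (sq : ∑ z, q z = 1) :
    (∑ z, |f z - q z|) ^ 2 ≤ 2 * ∑ z, f z * (Real.log (f z) - Real.log (q z)) := by
  have h1 := Finset.sq_sum_div_le_sum_sq_div Finset.univ (fun z => |f z - q z|)
    (g := fun z => 2 * f z + 4 * q z) (fun z _ => by have := hf z; have := hq z; positivity)
  have h2 := Finset.sum_le_sum (fun z (_ : z ∈ Finset.univ) => pinsker_term (hf z) (hq z))
  have h3 := h1.trans h2
  rw [← Finset.sum_div, Finset.sum_add_distrib, Finset.sum_add_distrib, Finset.sum_sub_distrib,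
    ← Finset.mul_sum, ← Finset.mul_sum, sf, sq] at h3
  rw [div_le_div_iff₀ (by norm_num) (by norm_num)] at h3
  linarith

theorem eta_one_sub {d : ℝ} (h0 : 0 ≤ d) (h1 : d ≤ 1 / 2) :
    Real.negMulLog (1 - d) ≤ Real.negMulLog d := by
  rcases h0.eq_or_lt with h | h
  · subst h; simp
  rcases h1.eq_or_lt with h' | h'
  · subst h'; norm_num
  have := (strictConcaveOn_log_Ioi.concaveOn.neg).secant_mono_aux1 (x := d) (y := 1 - d) (z := 1)
    h (by simp) (by linarith) (by linarith)
  simp [Real.negMulLog] at this ⊢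
  linarith

theorem eta_diff {x y : ℝ} (hx : 0 ≤ x) (hxy : x ≤ y) (hy : y ≤ 1) (hd : y - x ≤ 1 / 2) :
    |Real.negMulLog x - Real.negMulLog y| ≤ Real.negMulLog (y - x) := by
  rcases hxy.eq_or_lt with h | h
  · subst h; simp
  rw [abs_le]
  constructor
  · rcases hx.eq_or_lt with h' | h'
    · subst h'; simp
    · have a1 : Real.log x ≤ Real.log y := Real.log_le_log h' hxy
      have a2 : Real.log (y - x) ≤ Real.log y := Real.log_le_log (by linarith) (by linarith)
      simp only [Real.negMulLog]
      nlinarith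
  · refine le_trans ?_ (eta_one_sub (by linarith) hd)
    rcases hy.eq_or_lt with h' | h'
    · subst h'; simp
    · have c := Real.convexOn_mul_log
      have b1 := c.secant_mono_aux1 (x := x) (y := y) (z := 1) hx (by simp) h h'
      have b2 := c.secant_mono_aux1 (x := x) (y := 1 - (y - x)) (z := 1) hx (by simp)
        (by linarith) (by linarith)
      simp only [Real.negMulLog]
      simp only [Real.log_one, mul_zero] at b1 b2
      have : (1 - x) * (y * Real.log y + (1 - (y - x)) * Real.log (1 - (y - x)))
        ≤ (1 - x) * (x * Real.log x) := by nlinarith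
      have := le_of_mul_le_mul_left this (by linarith)
      linarith

theorem eta_diff' {x y : ℝ} (hx : 0 ≤ x) (hx1 : x ≤ 1) (hy : 0 ≤ y) (hy1 : y ≤ 1)
    (hd : |x - y| ≤ 1 / 2) :
    |Real.negMulLog x - Real.negMulLog y| ≤ Real.negMulLog |x - y| := by
  rcases le_total x y with h | h
  · rw [abs_sub_comm x y, abs_of_nonneg (sub_nonneg.2 h)] at *
    exact eta_diff hx h hy1 hd
  · rw [abs_of_nonneg (sub_nonneg.2 h)] at *
    rw [abs_sub_comm]
    exact eta_diff hy h hx1 hd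

theorem ent_diff {Z : Type*} [Fintype Z] (f q : Z → ℝ) (hf : ∀ z, 0 ≤ f z) (hq : ∀ z, 0 ≤ q z)
    (sf : ∑ z, f z = 1) (sq : ∑ z, q z = 1) (m : ℝ) (hm : m = Fintype.card Z) (hm2 : 2 ≤ m)
    (ε : ℝ) (hε0 : 0 < ε) (hε : ε ≤ 1 / 2) (hd : ∑ z, |f z - q z| ≤ ε) :
    |∑ z, Real.negMulLog (f z) - ∑ z, Real.negMulLog (q z)| ≤ ε * Real.log (m / ε) := by
  have le1 : ∀ g : Z → ℝ, (∀ z, 0 ≤ g z) → ∀ s, ∑ z, g z = s → ∀ z, g z ≤ s := by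
    intro g hg s hs z
    rw [← hs]
    exact Finset.single_le_sum (fun i _ => hg i) (Finset.mem_univ z)
  have hmpos : 0 < m := by linarith
  rw [← Finset.sum_sub_distrib]
  refine (Finset.abs_sum_le_sum_abs _ _).trans ?_
  have key : ∀ z, |Real.negMulLog (f z) - Real.negMulLog (q z)| ≤
      |f z - q z| * Real.log (m / ε) + ε / m - |f z - q z| := by
    intro z
    have hz := le1 _ (fun z => abs_nonneg (f z - q z)) _ rfl z
    refine (eta_diff' (hf z) (le1 f hf 1 sf z) (hq z) (le1 q hq 1 sq z) (by linarith)).trans ?_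
    rcases (abs_nonneg (f z - q z)).eq_or_lt with h | h
    · rw [← h]; simp; positivity
    · set d := |f z - q z|
      have := Real.log_le_sub_one_of_pos (x := ε / m / d) (by positivity)
      rw [Real.log_div (by positivity) h.ne', Real.log_div hε0.ne' hmpos.ne'] at this
      rw [Real.log_div hmpos.ne' hε0.ne', Real.negMulLog]
      have h2 := mul_le_mul_of_nonneg_left this h.le
      have e : d * (ε / m / d - 1) = ε / m - d := by field_simp
      rw [e] at h2
      linarith
  refine (Finset.sum_le_sum (fun z _ => key z)).trans ?_
  rw [Finset.sum_sub_distrib, Finset.sum_add_distrib, ← Finset.sum_mul, Finset.sum_const,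
    Finset.card_univ, nsmul_eq_mul, ← hm]
  have e : m * (ε / m) = ε := by field_simp
  rw [e]
  have hl : 1 ≤ Real.log (m / ε) := by
    rw [Real.le_log_iff_exp_le (by positivity), le_div_iff₀ hε0]
    have := Real.exp_one_lt_d9
    nlinarith [Real.exp_pos 1]
  nlinarith

theorem inducedProb_nonneg {Z : Type*} {f : Z → ℝ} (hf : ∀ z, 0 ≤ f z) (t : List Z) :
    0 ≤ inducedProb f t := by
  unfold inducedProb
  apply List.prod_nonneg
  intro a ha
  obtain ⟨z, _, rfl⟩ := List.mem_map.1 ha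
  exact hf z

theorem kraft {Z : Type*} [Fintype Z] [DecidableEq Z] (f : Z → ℝ) (hf : ∀ z, 0 ≤ f z)
    (sf : ∑ z, f z = 1) : ∀ (N : ℕ) (L : Finset (List Z)), (∀ t ∈ L, t.length ≤ N) →
    (∀ s ∈ L, ∀ t ∈ L, s <+: t → s = t) → ∑ t ∈ L, inducedProb f t ≤ 1 := by
  have hnil : ∀ L : Finset (List Z), (∀ s ∈ L, ∀ t ∈ L, s <+: t → s = t) → [] ∈ L →
      ∑ t ∈ L, inducedProb f t ≤ 1 := by
    intro L hp h
    have : L = {[]} := by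
      ext t
      simp only [Finset.mem_singleton]
      exact ⟨fun ht => (hp _ h _ ht List.nil_prefix).symm, fun ht => ht ▸ h⟩
    rw [this]; simp [inducedProb]
  intro N
  induction N with
  | zero =>
    intro L hl hp
    by_cases h : [] ∈ L
    · exact hnil L hp h
    · have : L = ∅ := by
        ext t
        simp only [Finset.notMem_empty, iff_false]
        intro ht
        have := hl t ht
        have : t = [] := List.length_eq_zero_iff.1 (by omega)
        exact h (this ▸ ht)
      rw [this]; simp
  | succ N ih =>
    intro L hl hp
    by_cases h : [] ∈ L
    · exact hnil L hp h
    · let T : Z → Finset (List Z) := fun z => L.preimage (List.cons z)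
        (fun a _ b _ hab => by simpa using hab)
      have hT : L = Finset.univ.biUnion (fun z => (T z).image (List.cons z)) := by
        ext t
        simp only [Finset.mem_biUnion, Finset.mem_univ, true_and, Finset.mem_image, T]
        constructor
        · intro ht
          cases t with
          | nil => exact absurd ht h
          | cons z s => exact ⟨z, s, Finset.mem_preimage.2 ht, rfl⟩
        · rintro ⟨z, s, hs, rfl⟩
          exact Finset.mem_preimage.1 hs
      have e : ∑ t ∈ L, inducedProb f t = ∑ z, f z * ∑ t ∈ T z, inducedProb f t := by
        conv_lhs => rw [hT]
        rw [Finset.sum_biUnion]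
        · refine Finset.sum_congr rfl (fun z _ => ?_)
          rw [Finset.sum_image (fun a _ b _ hab => by simpa using hab), Finset.mul_sum]
          refine Finset.sum_congr rfl (fun t _ => ?_)
          simp [inducedProb]
        · intro a _ b _ hab
          rw [Function.onFun, Finset.disjoint_left]
          intro t ha hb
          obtain ⟨s, _, rfl⟩ := Finset.mem_image.1 ha
          obtain ⟨s', _, hs'⟩ := Finset.mem_image.1 hb
          simp at hs'
          exact hab hs'.1.symm
      rw [e, ← sf]
      refine Finset.sum_le_sum (fun z _ => ?_)
      have := ih (T z) (fun t ht => by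
          have := hl _ (Finset.mem_preimage.1 ht); simpa using this)
        (fun s hs t ht hst => by
          have := hp _ (Finset.mem_preimage.1 hs) _ (Finset.mem_preimage.1 ht)
            (by simpa using hst)
          simpa using this)
      exact mul_le_of_le_one_right (hf z) this

theorem log_induced {Z : Type*} [Fintype Z] [DecidableEq Z] (f : Z → ℝ) (t : List Z)
    (h : ∀ z ∈ t, f z ≠ 0) :
    Real.log (inducedProb f t) = ∑ z, (t.count z : ℝ) * Real.log (f z) := by
  induction t with
  | nil => simp [inducedProb]
  | cons a t ih =>
    have ih' := ih (fun z hz => h z (List.mem_cons_of_mem _ hz))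
    have hne : inducedProb f t ≠ 0 := by
      unfold inducedProb
      apply List.prod_ne_zero
      intro h0
      obtain ⟨z, hz, hz0⟩ := List.mem_map.1 h0
      exact h z (List.mem_cons_of_mem _ hz) hz0
    have : inducedProb f (a :: t) = f a * inducedProb f t := by simp [inducedProb]
    rw [this, Real.log_mul (h a (by simp)) hne, ih']
    simp only [List.count_cons, Nat.cast_add, add_mul, Finset.sum_add_distrib]
    rw [add_comm]
    congr 1
    simp 

theorem sum_count {Z : Type*} [Fintype Z] [DecidableEq Z] (t : List Z) :
    ∑ z, (t.count z : ℝ) = t.length := by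
  induction t with
  | nil => simp
  | cons a t ih =>
    simp only [List.count_cons, Nat.cast_add, Finset.sum_add_distrib, ih, List.length_cons]
    congr 1
    simp

/-- The main estimate in nats. -/
theorem main_nats {Z : Type*} [Fintype Z] [DecidableEq Z]
    (L : Finset (List Z)) (hL : IsCompleteLeafSet L)
    (m : ℝ) (hm : m = Fintype.card Z) (hm2 : 2 ≤ m)
    (q : Z → ℝ) (hq : ∀ z : Z, 0 < q z) (sq : ∑ z : Z, q z = 1)
    (P : List Z → ℝ) (hP : ∀ t ∈ L, 0 ≤ P t) (sP : ∑ t ∈ L, P t = 1)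
    (ε : ℝ) (hε0 : 0 < ε) (hε : ε ≤ 1 / 2) (D H E : ℝ) (hE : E = expLen L P)
    (hD : D = ∑ t ∈ L, P t * Real.log (P t / inducedProb q t))
    (hH : H = ∑ t ∈ L, Real.negMulLog (P t))
    (hdiv : D / E ≤ ε ^ 2 / 2) :
    |H / E - ∑ z, Real.negMulLog (q z)| ≤ ε * Real.log (m / ε) + ε ^ 2 / 2 := by
  have hE1 : 1 ≤ E := by
    rw [hE, expLen, ← sP]
    refine Finset.sum_le_sum (fun t ht => ?_)
    have : 1 ≤ t.length := List.length_pos_iff.2 (hL.1 t ht)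
    have : (1 : ℝ) ≤ t.length := by exact_mod_cast this
    nlinarith [hP t ht]
  have hE0 : 0 < E := by linarith
  let f : Z → ℝ := fun z => (∑ t ∈ L, P t * (t.count z : ℝ)) / E
  have hfE : ∀ g : Z → ℝ, ∑ t ∈ L, P t * ∑ z, (t.count z : ℝ) * g z = E * ∑ z, f z * g z := by
    intro g
    simp only [Finset.mul_sum, f]
    rw [Finset.sum_comm]
    refine Finset.sum_congr rfl (fun z _ => ?_)
    rw [← mul_assoc, mul_div_cancel₀ _ hE0.ne', Finset.sum_mul]
    exact Finset.sum_congr rfl (fun t _ => by ring)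
  have hf : ∀ z, 0 ≤ f z := fun z =>
    div_nonneg (Finset.sum_nonneg (fun t ht => mul_nonneg (hP t ht) (by positivity))) hE0.le
  have sf : ∑ z, f z = 1 := by
    have := hfE (fun _ => 1)
    simp only [mul_one, sum_count] at this
    have h2 : E = E * ∑ z, f z := by rw [← this, hE, expLen]
    have h3 : E * 1 = E * ∑ z, f z := by linarith
    exact (mul_left_cancel₀ hE0.ne' h3).symm
  have hfpos : ∀ t ∈ L, 0 < P t → ∀ z ∈ t, 0 < f z := by
    intro t ht hpt z hz
    refine div_pos ?_ hE0
    refine Finset.sum_pos' (fun t ht => mul_nonneg (hP t ht) (by positivity)) ⟨t, ht, ?_⟩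
    have : 0 < t.count z := List.count_pos_iff.2 hz
    positivity
  have hK : ∑ t ∈ L, inducedProb f t ≤ 1 :=
    kraft f hf sf (L.sup List.length) L (fun t ht => Finset.le_sup ht) hL.2.1
  -- Gibbs inequality
  have hG : ∑ t ∈ L, P t * ∑ z, (t.count z : ℝ) * Real.log (f z) ≤
      ∑ t ∈ L, P t * Real.log (P t) := by
    have : ∀ t ∈ L, P t * ∑ z, (t.count z : ℝ) * Real.log (f z) ≤
        P t * Real.log (P t) + (inducedProb f t - P t) := by
      intro t ht
      rcases (hP t ht).eq_or_lt with h | h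
      · rw [← h]; simp; exact inducedProb_nonneg hf t
      · rw [← log_induced f t (fun z hz => (hfpos t ht h z hz).ne')]
        have hpos : 0 < inducedProb f t := by
          unfold inducedProb
          apply List.prod_pos
          intro a ha
          obtain ⟨z, hz, rfl⟩ := List.mem_map.1 ha
          exact hfpos t ht h z hz
        have h1 := Real.log_le_sub_one_of_pos (div_pos hpos h)
        rw [Real.log_div hpos.ne' h.ne'] at h1
        have h2 := mul_le_mul_of_nonneg_left h1 h.le
        have e : P t * (inducedProb f t / P t - 1) = inducedProb f t - P t := by field_simp
        rw [e] at h2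
        linarith
    have := Finset.sum_le_sum this
    rw [Finset.sum_add_distrib, Finset.sum_sub_distrib, sP] at this
    linarith
  have hD2 : D = - H - E * ∑ z, f z * Real.log (q z) := by
    rw [hD, hH, ← hfE, ← Finset.sum_neg_distrib, ← Finset.sum_sub_distrib]
    refine Finset.sum_congr rfl (fun t ht => ?_)
    rcases (hP t ht).eq_or_lt with h | h
    · rw [← h]; simp
    · have hpos : 0 < inducedProb q t := by
        unfold inducedProb
        apply List.prod_pos
        intro a ha
        obtain ⟨z, hz, rfl⟩ := List.mem_map.1 ha
        exact hq z
      rw [Real.log_div h.ne' hpos.ne', log_induced q t (fun z _ => (hq z).ne'), Real.negMulLog]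
      ring
  rw [hfE] at hG
  have hH2 : ∑ t ∈ L, P t * Real.log (P t) = - H := by
    rw [hH, ← Finset.sum_neg_distrib]
    exact Finset.sum_congr rfl (fun t _ => by simp [Real.negMulLog])
  rw [hH2] at hG
  have hN : ∑ z, f z * Real.log (f z) = - ∑ z, Real.negMulLog (f z) := by
    rw [← Finset.sum_neg_distrib]
    exact Finset.sum_congr rfl (fun t _ => by simp [Real.negMulLog])
  have hp := pinsker f q hf hq sf sq
  have hs : ∑ z, f z * (Real.log (f z) - Real.log (q z)) =
      ∑ z, f z * Real.log (f z) - ∑ z, f z * Real.log (q z) := by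
    rw [← Finset.sum_sub_distrib]
    exact Finset.sum_congr rfl (fun t _ => by ring)
  rw [hs] at hp
  set A := ∑ z, f z * Real.log (f z)
  set B := ∑ z, f z * Real.log (q z)
  have hDE : D / E = - (H / E) - B := by rw [hD2]; field_simp
  have hAE : A ≤ - (H / E) := by
    have : A ≤ (- H) / E := by rw [le_div_iff₀ hE0]; linarith
    rwa [neg_div] at this
  have hδ : ∑ z, |f z - q z| ≤ ε := by
    refine (pow_le_pow_iff_left₀ (Finset.sum_nonneg (fun z _ => abs_nonneg _)) hε0.le two_ne_zero).1 ?_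
    linarith
  have := ent_diff f q hf (fun z => (hq z).le) sf sq m hm hm2 ε hε0 hε hδ
  rw [abs_le] at this ⊢
  have h0 : 0 ≤ (∑ z, |f z - q z|) ^ 2 := by positivity
  have h00 := sq_nonneg ε
  constructor <;> linarith [this.1, this.2]

theorem theta_bound {m ε : ℝ} (hm2 : 2 ≤ m) (hε0 : 0 < ε) (hε : ε ≤ 1 / 2) :
    0 ≤ ε ^ 2 / Real.logb 2 m * Real.logb 2 (m / (Real.exp 1 * ε)) ∧
    ε ^ 2 / Real.logb 2 m * Real.logb 2 (m / (Real.exp 1 * ε)) ≤ ε := by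
  have l2 : 0 < Real.log 2 := Real.log_pos (by norm_num)
  have l2' := Real.log_two_gt_d9
  have l2'' := Real.log_two_lt_d9
  have hM : Real.log 2 ≤ Real.log m := Real.log_le_log (by norm_num) hm2
  have hM0 : 0 < Real.log m := by linarith
  have e : ε ^ 2 / Real.logb 2 m * Real.logb 2 (m / (Real.exp 1 * ε)) =
      ε * (ε * (Real.log m - 1 - Real.log ε) / Real.log m) := by
    rw [Real.logb, Real.logb, Real.log_div (by linarith) (by positivity),
      Real.log_mul (by positivity) hε0.ne', Real.log_exp]
    field_simp
    ring
  have ha : Real.log ε ≤ - Real.log 2 := by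
    rw [← Real.log_inv]; exact Real.log_le_log hε0 (by linarith)
  have hb := Real.log_le_sub_one_of_pos (x := 1 / (4 * ε)) (by positivity)
  have e4 : Real.log (1 / (4 * ε)) = - 2 * Real.log 2 - Real.log ε := by
    rw [one_div, Real.log_inv, Real.log_mul (by norm_num) hε0.ne',
      show (4 : ℝ) = 2 ^ 2 by norm_num, Real.log_pow]
    push_cast; ring
  rw [e4] at hb
  have hb2 := mul_le_mul_of_nonneg_left hb hε0.le
  have e5 : ε * (1 / (4 * ε) - 1) = 1 / 4 - ε := by field_simp
  rw [e5] at hb2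
  rw [e]
  constructor
  · have : 0 ≤ Real.log m - 1 - Real.log ε := by linarith
    positivity
  · apply mul_le_of_le_one_right hε0.le
    rw [div_le_one hM0]
    nlinarith

/-- **Normalized divergence controls entropy rate.** With `m = |Z| ≥ 2`,
`θ(ε) = (ε²/log₂ m) log₂(m/(eε))` and `σ(ε) = ε log₂(m²/(eε²))` for `0 < ε ≤ 1/2`:
if `D(P_Y ‖ P_Z^L)/E[ℓ(Y)] ≤ θ(ε)²/(2 ln 2)` then
`|H(P_Y)/E[ℓ(Y)] − H(P_Z)| ≤ σ(ε)`. -/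
theorem divergence_controls_entropy_rate {Z : Type*} [Fintype Z] [DecidableEq Z]
    (L : Finset (List Z)) (hL : IsCompleteLeafSet L)
    (hZ : 2 ≤ Fintype.card Z)
    (PZ : Z → ℝ) (hZpos : ∀ z : Z, 0 < PZ z) (hZsum : ∑ z : Z, PZ z = 1)
    (P : List Z → ℝ) (hPnn : ∀ t ∈ L, 0 ≤ P t) (hPsum : ∑ t ∈ L, P t = 1)
    (ε : ℝ) (hε0 : 0 < ε) (hε : ε ≤ 1 / 2)
    (hdiv : kl L P (inducedProb PZ) / expLen L P ≤
      (ε ^ 2 / Real.logb 2 (Fintype.card Z) *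
        Real.logb 2 (Fintype.card Z / (Real.exp 1 * ε))) ^ 2 / (2 * Real.log 2)) :
    |ent L P / expLen L P - ent Finset.univ PZ| ≤
      ε * Real.logb 2 ((Fintype.card Z : ℝ) ^ 2 / (Real.exp 1 * ε ^ 2)) := by
  have l2 : 0 < Real.log 2 := Real.log_pos (by norm_num)
  have hm2 : (2 : ℝ) ≤ (Fintype.card Z : ℝ) := by exact_mod_cast hZ
  obtain ⟨t0, t1⟩ := theta_bound hm2 hε0 hε
  have hkl : kl L P (inducedProb PZ) =
      (∑ t ∈ L, P t * Real.log (P t / inducedProb PZ t)) / Real.log 2 := by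
    rw [kl, Finset.sum_div]
    exact Finset.sum_congr rfl (fun t _ => by rw [Real.logb]; ring)
  have hent : ent L P = (∑ t ∈ L, Real.negMulLog (P t)) / Real.log 2 := by
    rw [ent, Finset.sum_div]
    exact Finset.sum_congr rfl (fun t _ => by rw [Real.logb, Real.negMulLog]; ring)
  have hentZ : ent Finset.univ PZ = (∑ z, Real.negMulLog (PZ z)) / Real.log 2 := by
    rw [ent, Finset.sum_div]
    exact Finset.sum_congr rfl (fun t _ => by rw [Real.logb, Real.negMulLog]; ring)
  have hdiv2 : (∑ t ∈ L, P t * Real.log (P t / inducedProb PZ t)) / expLen L P ≤ ε ^ 2 / 2 := by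
    have h1 := pow_le_pow_left₀ t0 t1 2
    have h2 := hdiv.trans (div_le_div_of_nonneg_right h1 (by positivity))
    rw [hkl, div_right_comm, div_le_iff₀ l2] at h2
    refine h2.trans (le_of_eq ?_)
    field_simp
  have key := main_nats L hL _ rfl hm2 PZ hZpos hZsum P hPnn hPsum ε hε0 hε _ _ _ rfl rfl rfl hdiv2
  rw [hent, hentZ, div_right_comm, ← sub_div, abs_div, abs_of_pos l2, div_le_iff₀ l2]
  refine key.trans ?_
  have hmpos : (0 : ℝ) < Fintype.card Z := by linarith
  have e : ε * Real.logb 2 ((Fintype.card Z : ℝ) ^ 2 / (Real.exp 1 * ε ^ 2)) * Real.log 2 =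
      ε * (2 * Real.log (Fintype.card Z) - 1 - 2 * Real.log ε) := by
    rw [Real.logb, Real.log_div (by positivity) (by positivity),
      Real.log_mul (by positivity) (by positivity), Real.log_exp, Real.log_pow, Real.log_pow]
    field_simp
    push_cast
    ring
  rw [e, Real.log_div hmpos.ne' hε0.ne']
  have hM : Real.log 2 ≤ Real.log (Fintype.card Z : ℝ) := Real.log_le_log (by norm_num) hm2
  have ha : Real.log ε ≤ - Real.log 2 := by
    rw [← Real.log_inv]; exact Real.log_le_log hε0 (by linarith)
  have l2' := Real.log_two_gt_d9
  nlinarith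
end
end

section
/- (Converse for exact generation of a DMS) Let X and Z be finite alphabets with |Z| ≥ 2, let P_X be a probability distribution on X with H(P_X) > 0, and let P_Z be a probability distribution on Z. Let Dic be a complete leaf set over X (the dictionary), C a complete leaf set over Z (the codebook), and f : Dic → C any function. Let P_D := P_X^Dic be the induced leaf distribution on Dic and let P_Y be the pushforward of P_D under f, i.e., P_Y(c) := Σ_{d ∈ Dic: f(d) = c} P_D(d). If P_Y = P_Z^C (exact generation), then E[ℓ(D)]/E[ℓ(Y)] ≥ H(P_Z)/H(P_X), where E[ℓ(D)] := Σ_{d ∈ Dic} P_D(d) ℓ(d) and E[ℓ(Y)] := Σ_{c ∈ C} P_Y(c) ℓ(c). -/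
open Finset

noncomputable section

/-- The pushforward of a distribution on the dictionary under an encoding map. -/
def pushf {X Z : Type*} [DecidableEq Z] (Dic : Finset (List X)) (f : List X → List Z)
    (P : List X → ℝ) (c : List Z) : ℝ :=
  ∑ d ∈ Dic.filter (fun d => f d = c), P d

theorem sum_cons_decomp {A : Type*} [Fintype A] [DecidableEq A] (L : Finset (List A))
    (h : [] ∉ L) (F : List A → ℝ) :
    ∑ t ∈ L, F t = ∑ a : A, ∑ t ∈ L.preimage (List.cons a) (List.cons_injective.injOn),
      F (a :: t) := by
  rw [Finset.sum_sigma']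
  symm
  refine Finset.sum_bij (fun p _ => p.1 :: p.2) ?_ ?_ ?_ ?_
  · rintro ⟨a, t⟩ hp
    simpa using hp
  · rintro ⟨a, t⟩ _ ⟨b, s⟩ _ hab
    simp only [List.cons.injEq] at hab
    obtain ⟨rfl, rfl⟩ := hab
    rfl
  · intro t ht
    cases t with
    | nil => exact absurd ht h
    | cons a t => exact ⟨⟨a, t⟩, by simpa using ht, rfl⟩
  · intro p _
    rfl

theorem wald_aux {A : Type*} [Fintype A] [DecidableEq A] (P φ : A → ℝ)
    (hP : ∑ a, P a = 1) (hφ : ∑ a, P a * φ a = 0) (N : ℕ) :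
    ∀ L : Finset (List A), (∀ s ∈ L, ∀ t ∈ L, s <+: t → s = t) →
      (∀ s : List A, N ≤ s.length → ∃ t, t ∈ L ∧ t <+: s) →
      ∑ t ∈ L, inducedProb P t = 1 ∧ ∑ t ∈ L, inducedProb P t * (t.map φ).sum = 0 := by
  have base : ∀ L : Finset (List A), (∀ s ∈ L, ∀ t ∈ L, s <+: t → s = t) → [] ∈ L →
      ∑ t ∈ L, inducedProb P t = 1 ∧ ∑ t ∈ L, inducedProb P t * (t.map φ).sum = 0 := by
    intro L h1 h0
    have : L = {[]} := by
      ext t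
      simp only [Finset.mem_singleton]
      constructor
      · intro ht
        exact (h1 [] h0 t ht List.nil_prefix).symm
      · rintro rfl
        exact h0
    subst this
    simp [inducedProb]
  induction N with
  | zero =>
    intro L h1 h2
    obtain ⟨t, ht, hp⟩ := h2 [] le_rfl
    rw [List.prefix_nil] at hp
    subst hp
    exact base L h1 ht
  | succ n ih =>
    intro L h1 h2
    by_cases h0 : [] ∈ L
    · exact base L h1 h0
    have key : ∀ a : A, _ := fun a =>
      ih (L.preimage (List.cons a) (List.cons_injective.injOn))
        (by
          intro s hs t ht hst
          rw [Finset.mem_preimage] at hs ht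
          have := h1 _ hs _ ht (by simpa using hst)
          simpa using this)
        (by
          intro s hs
          obtain ⟨t, ht, hp⟩ := h2 (a :: s) (by simpa using hs)
          cases t with
          | nil => exact absurd ht h0
          | cons b t =>
            rw [List.cons_prefix_cons] at hp
            obtain ⟨rfl, hp⟩ := hp
            exact ⟨t, by simpa using ht, hp⟩)
    rw [sum_cons_decomp L h0, sum_cons_decomp L h0]
    have hc : ∀ a t, inducedProb P (a :: t) = P a * inducedProb P t := by
      intro a t
      simp [inducedProb]
    constructor
    · simp only [hc, ← Finset.mul_sum, (key _).1, mul_one, hP]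
    · rw [← hφ]
      refine Finset.sum_congr rfl fun a _ => ?_
      have : ∀ t : List A, inducedProb P (a :: t) * ((a :: t).map φ).sum
          = (P a * φ a) * inducedProb P t + P a * (inducedProb P t * (t.map φ).sum) := by
        intro t
        rw [hc, List.map_cons, List.sum_cons]
        ring
      simp only [this, Finset.sum_add_distrib, ← Finset.mul_sum, (key a).1, (key a).2]
      ring

theorem inducedProb_nonneg_s13 {A : Type*} (P : A → ℝ) (hP : ∀ a, 0 ≤ P a) (t : List A) :
    0 ≤ inducedProb P t := by
  induction t with
  | nil => simp [inducedProb]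
  | cons a t ih =>
    have : inducedProb P (a :: t) = P a * inducedProb P t := by simp [inducedProb]
    rw [this]
    exact mul_nonneg (hP a) ih

theorem log_aux {A : Type*} (P : A → ℝ) (m : ℝ) (t : List A) :
    inducedProb P t * (t.map fun a => -Real.logb 2 (P a) - m).sum
      = -(inducedProb P t * Real.logb 2 (inducedProb P t)) - inducedProb P t * t.length * m := by
  by_cases h : inducedProb P t = 0
  · simp [h]
  have : (t.map fun a => -Real.logb 2 (P a) - m).sum
      = -Real.logb 2 (inducedProb P t) - t.length * m := by
    induction t with
    | nil => simp [inducedProb]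
    | cons a t ih =>
      have hc : inducedProb P (a :: t) = P a * inducedProb P t := by simp [inducedProb]
      rw [hc] at h ⊢
      obtain ⟨h1, h2⟩ := mul_ne_zero_iff.mp h
      rw [List.map_cons, List.sum_cons, ih h2, Real.logb_mul h1 h2]
      push_cast [List.length_cons]
      ring
  rw [this]
  ring

theorem leaf_entropy {A : Type*} [Fintype A] [DecidableEq A] (P : A → ℝ)
    (hP : ∑ a, P a = 1) (L : Finset (List A)) (hL : IsCompleteLeafSet L) :
    ∑ t ∈ L, inducedProb P t = 1 ∧
      ent L (inducedProb P) = expLen L (inducedProb P) * ent Finset.univ P := by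
  obtain ⟨_, h1, N, h2⟩ := hL
  have := wald_aux P (fun a => -Real.logb 2 (P a) - ent Finset.univ P) hP (by
    simp only [mul_sub, Finset.sum_sub_distrib, ← Finset.sum_mul, hP]
    simp [ent]) N L h1 (fun s hs => (h2 s hs).exists)
  refine ⟨this.1, ?_⟩
  have h := this.2
  simp only [log_aux, Finset.sum_sub_distrib, ← Finset.sum_mul] at h
  unfold expLen
  rw [ent]
  linarith

theorem ent_pushf_le {X Z : Type*} [DecidableEq Z] (Dic : Finset (List X)) (C : Finset (List Z))
    (f : List X → List Z) (hf : ∀ d ∈ Dic, f d ∈ C) (P : List X → ℝ) (hP : ∀ d, 0 ≤ P d) :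
    ent C (pushf Dic f P) ≤ ent Dic P := by
  have : ent C (pushf Dic f P) = ∑ d ∈ Dic, -(P d * Real.logb 2 (pushf Dic f P (f d))) := by
    rw [ent, ← Finset.sum_fiberwise_of_maps_to hf]
    refine Finset.sum_congr rfl fun c _ => ?_
    rw [Finset.sum_congr rfl (g := fun d => -(P d * Real.logb 2 (pushf Dic f P c)))]
    · rw [Finset.sum_neg_distrib, ← Finset.sum_mul]
      rfl
    · intro d hd
      rw [(Finset.mem_filter.mp hd).2]
  rw [this, ent]
  refine Finset.sum_le_sum fun d hd => ?_
  rcases (hP d).eq_or_lt with h | h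
  · simp [← h]
  have hle : P d ≤ pushf Dic f P (f d) :=
    Finset.single_le_sum (f := P) (fun i _ => hP i) (by simp [hd])
  have := Real.logb_le_logb_of_le (b := 2) (by norm_num) h hle
  nlinarith

/-- **Converse for exact generation of a DMS.** If a deterministic encoder
`f : Dic → C` applied to the parsed DMS `P_X` generates exactly `P_Z^C`, then
`E[ℓ(D)]/E[ℓ(Y)] ≥ H(P_Z)/H(P_X)`. -/
theorem exact_generation_converse {X Z : Type*}
    [Fintype X] [DecidableEq X] [Fintype Z] [DecidableEq Z]
    (hZ : 2 ≤ Fintype.card Z)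
    (PX : X → ℝ) (hXnn : ∀ x : X, 0 ≤ PX x) (hXsum : ∑ x : X, PX x = 1)
    (hHX : 0 < ent Finset.univ PX)
    (PZ : Z → ℝ) (hZnn : ∀ z : Z, 0 ≤ PZ z) (hZsum : ∑ z : Z, PZ z = 1)
    (Dic : Finset (List X)) (hDic : IsCompleteLeafSet Dic)
    (C : Finset (List Z)) (hC : IsCompleteLeafSet C)
    (f : List X → List Z) (hf : ∀ d ∈ Dic, f d ∈ C)
    (hexact : ∀ c ∈ C, pushf Dic f (inducedProb PX) c = inducedProb PZ c) :
    ent Finset.univ PZ / ent Finset.univ PX ≤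
      expLen Dic (inducedProb PX) / expLen C (pushf Dic f (inducedProb PX)) := by
  obtain ⟨_, hD⟩ := leaf_entropy PX hXsum Dic hDic
  obtain ⟨hC1, hCe⟩ := leaf_entropy PZ hZsum C hC
  have hle := ent_pushf_le Dic C f hf (inducedProb PX) (inducedProb_nonneg_s13 PX hXnn)
  have e1 : ent C (pushf Dic f (inducedProb PX)) = ent C (inducedProb PZ) :=
    Finset.sum_congr rfl fun c hc => by rw [hexact c hc]
  have e2 : expLen C (pushf Dic f (inducedProb PX)) = expLen C (inducedProb PZ) :=
    Finset.sum_congr rfl fun c hc => by rw [hexact c hc]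
  have hpos : 0 < expLen C (inducedProb PZ) := by
    refine lt_of_lt_of_le one_pos ?_
    rw [← hC1]
    refine Finset.sum_le_sum fun c hc => ?_
    have : (1 : ℝ) ≤ c.length := by
      exact_mod_cast List.length_pos_iff.mpr (hC.1 c hc)
    nlinarith [inducedProb_nonneg_s13 PZ hZnn c]
  rw [e1, hCe, hD] at hle
  rw [e2, div_le_div_iff₀ hHX hpos]
  linarith
end
end

section
/- (Converse for random encoders / distribution matching) Let X and Z be finite alphabets with m := |Z| ≥ 2, let P_X be a probability distribution on X with H(P_X) > 0, and let P_Z be a probability distribution on Z with P_Z(z) > 0 for all z ∈ Z. Let Dic be a complete leaf set over X, C a complete leaf set over Z, and let P_{DY} be a joint probability distribution on Dic × C whose Dic-marginal is P_D := P_X^Dic and whose C-marginal is P_Y. Let g : C → Dic be any (decoding) function and let P_e := Pr{g(Y) ≠ D} = Σ_{(d,c): g(c) ≠ d} P_{DY}(d,c). For 0 < ε ≤ 1/2 define θ(ε) := (ε² / log₂ m) · log₂(m/(e·ε)) and σ(ε) := ε · log₂(m²/(e·ε²)), and let H₂ denote the binary entropy function. If P_e ≤ ε' ≤ 1/2 and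 D(P_Y ‖ P_Z^C)/E[ℓ(Y)] ≤ θ(ε)²/(2 ln 2), then E[ℓ(D)]/E[ℓ(Y)] ≤ H(P_Z)/H(P_X) + σ(ε)/H(P_X) + (H₂(ε') + ε' · log₂|Dic|)/(E[ℓ(Y)] · H(P_X)), where E[ℓ(D)] := Σ_{d ∈ Dic} P_D(d) ℓ(d) and E[ℓ(Y)] := Σ_{c ∈ C} P_Y(c) ℓ(c). -/
open Finset

noncomputable section

/-- The `C`-marginal of a joint distribution on `Dic × C`. -/
def margY {X Z : Type*} (Dic : Finset (List X)) (PDY : List X → List Z → ℝ)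
    (c : List Z) : ℝ :=
  ∑ d ∈ Dic, PDY d c

/-- The binary entropy function in bits. -/
def binEnt (p : ℝ) : ℝ := -(p * Real.logb 2 p) - (1 - p) * Real.logb 2 (1 - p)

namespace REC

variable {X Z : Type*}

/-- Wald-type identity on complete leaf sets. -/
lemma wald [Fintype X] [DecidableEq X] (P h : X → ℝ) (hs : ∑ x, P x = 1)
    (hh : ∑ x, P x * h x = 0) (N : ℕ) : ∀ (L : Finset (List X)) (a : ℝ),
    (∀ s ∈ L, ∀ t ∈ L, s <+: t → s = t) →
    (∀ s : List X, N ≤ s.length → ∃ t, t ∈ L ∧ t <+: s) →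
    ∑ t ∈ L, inducedProb P t * (a + (t.map h).sum) = a := by
  have base : ∀ (L : Finset (List X)) (a : ℝ), [] ∈ L →
      (∀ s ∈ L, ∀ t ∈ L, s <+: t → s = t) →
      ∑ t ∈ L, inducedProb P t * (a + (t.map h).sum) = a := by
    intro L a h0 hp
    have : L = {[]} := by
      ext t
      simp only [Finset.mem_singleton]
      constructor
      · intro ht
        exact (hp [] h0 t ht List.nil_prefix).symm
      · rintro rfl; exact h0
    subst this
    simp [inducedProb]
  induction N with
  | zero =>
    intro L a hp hc
    obtain ⟨t, ht, htp⟩ := hc [] (by simp)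
    have : t = [] := List.prefix_nil.mp htp
    subst this
    exact base L a ht hp
  | succ N ih =>
    intro L a hp hc
    by_cases h0 : [] ∈ L
    · exact base L a h0 hp
    let T : X → Finset (List X) := fun x =>
      L.preimage (fun u => x :: u) (fun u _ v _ e => by simpa using e)
    have hT : ∀ x u, u ∈ T x ↔ x :: u ∈ L := by
      intro x u; exact Finset.mem_preimage
    have hL : L = Finset.univ.biUnion (fun x => (T x).image (fun u => x :: u)) := by
      ext t
      cases t with
      | nil => simp [h0]
      | cons y u => simp [hT]
    have key : ∑ t ∈ L, inducedProb P t * (a + (t.map h).sum)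
        = ∑ x, ∑ u ∈ T x, inducedProb P (x :: u) * (a + ((x :: u).map h).sum) := by
      conv_lhs => rw [hL]
      rw [Finset.sum_biUnion]
      · refine Finset.sum_congr rfl fun x _ => ?_
        rw [Finset.sum_image]
        intro u _ v _ e
        simpa using e
      · intro x _ y _ hxy
        rw [Function.onFun, Finset.disjoint_left]
        intro t h1 h2
        simp only [Finset.mem_image] at h1 h2
        obtain ⟨u, _, rfl⟩ := h1
        obtain ⟨v, _, e⟩ := h2
        simp only [List.cons.injEq] at e
        exact hxy e.1.symm
    rw [key]
    have step : ∀ x, ∑ u ∈ T x, inducedProb P (x :: u) * (a + ((x :: u).map h).sum)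
        = P x * (a + h x) := by
      intro x
      have := ih (T x) (a + h x) (by
        intro s hs' t ht hst
        have := hp (x :: s) ((hT x s).1 hs') (x :: t) ((hT x t).1 ht) (by simpa using hst)
        simpa using this) (by
        intro s hs'
        obtain ⟨t, ht, htp⟩ := hc (x :: s) (by simpa using hs')
        cases t with
        | nil => exact absurd ht h0
        | cons y u =>
          rw [List.cons_prefix_cons] at htp
          obtain ⟨rfl, h2⟩ := htp
          exact ⟨u, (hT y u).2 ht, h2⟩)
      rw [← this, Finset.mul_sum]
      refine Finset.sum_congr rfl fun u _ => ?_
      simp only [inducedProb, List.map_cons, List.prod_cons, List.sum_cons]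
      ring
    simp_rw [step, mul_add]
    rw [Finset.sum_add_distrib, ← Finset.sum_mul, hs, hh]
    ring

lemma inducedProb_nonneg (P : X → ℝ) (hP : ∀ x, 0 ≤ P x) (t : List X) :
    0 ≤ inducedProb P t := by
  unfold inducedProb
  apply List.prod_nonneg
  intro a ha
  obtain ⟨x, _, rfl⟩ := List.mem_map.1 ha
  exact hP x

lemma log_inducedProb (P : X → ℝ) (t : List X) (h : inducedProb P t ≠ 0) :
    Real.log (inducedProb P t) = (t.map (fun x => Real.log (P x))).sum := by
  induction t with
  | nil => simp [inducedProb]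
  | cons x u ih =>
    have e : inducedProb P (x :: u) = P x * inducedProb P u := by simp [inducedProb]
    rw [e] at h ⊢
    rw [Real.log_mul (left_ne_zero_of_mul h) (right_ne_zero_of_mul h),
      ih (right_ne_zero_of_mul h)]
    simp

lemma sum_inducedProb [Fintype X] [DecidableEq X] (P : X → ℝ) (hs : ∑ x, P x = 1)
    (L : Finset (List X)) (hL : IsCompleteLeafSet L) :
    ∑ t ∈ L, inducedProb P t = 1 := by
  obtain ⟨_, hp, N, hN⟩ := hL
  have := wald P (fun _ => 0) hs (by simp) N L 1 hp (fun s h => (hN s h).exists)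
  simpa using this

/-- entropy in nats -/
def entN {α : Type*} (S : Finset α) (P : α → ℝ) : ℝ := ∑ x ∈ S, -(P x * Real.log (P x))

lemma ent_eq {α : Type*} (S : Finset α) (P : α → ℝ) : ent S P = entN S P / Real.log 2 := by
  unfold ent entN Real.logb
  rw [Finset.sum_div]
  refine Finset.sum_congr rfl fun x _ => by ring

lemma ent_leaf [Fintype X] [DecidableEq X] (P : X → ℝ) (hs : ∑ x, P x = 1)
    (L : Finset (List X)) (hL : IsCompleteLeafSet L) :
    entN L (inducedProb P) = entN Finset.univ P * expLen L (inducedProb P) := by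
  obtain ⟨_, hp, N, hN⟩ := hL
  have := wald P (fun x => -Real.log (P x) - entN Finset.univ P) hs (by
    simp only [mul_sub, Finset.sum_sub_distrib]
    rw [← Finset.sum_mul, hs]
    simp [entN]) N L 0 hp (fun s h => (hN s h).exists)
  unfold expLen
  rw [Finset.mul_sum, ← sub_eq_zero, entN, ← Finset.sum_sub_distrib]
  refine Eq.trans (Finset.sum_congr rfl fun t _ => ?_) this
  have e : ∀ t : List X, (t.map (fun x => -Real.log (P x) - entN Finset.univ P)).sum
      = -(t.map (fun x => Real.log (P x))).sum - t.length * entN Finset.univ P := by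
    intro t
    induction t with
    | nil => simp
    | cons x u ih => simp only [List.map_cons, List.sum_cons, ih, List.length_cons]; push_cast; ring
  rw [e]
  by_cases h0 : inducedProb P t = 0
  · simp [h0]
  · rw [log_inducedProb P t h0]; ring

lemma gibbs_pt {p r : ℝ} (hp : 0 ≤ p) (hr : 0 ≤ r) (h : r = 0 → p = 0) :
    -(p * Real.log p) ≤ -(p * Real.log r) + (r - p) := by
  rcases hp.eq_or_lt with rfl | hp
  · simpa using hr
  have hr' : 0 < r := lt_of_le_of_ne hr (fun e => hp.ne' (h e.symm))
  have := Real.log_le_sub_one_of_pos (div_pos hr' hp)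
  rw [Real.log_div hr'.ne' hp.ne'] at this
  have h2 := mul_le_mul_of_nonneg_left this hp.le
  have : p * (r / p - 1) = r - p := by field_simp
  nlinarith

lemma gibbs {α : Type*} (S : Finset α) (p r : α → ℝ) (hp : ∀ x ∈ S, 0 ≤ p x)
    (hr : ∀ x ∈ S, 0 ≤ r x) (h : ∀ x ∈ S, r x = 0 → p x = 0)
    (hsum : ∑ x ∈ S, r x ≤ ∑ x ∈ S, p x) :
    entN S p ≤ ∑ x ∈ S, -(p x * Real.log (r x)) := by
  have := Finset.sum_le_sum (fun x hx => gibbs_pt (hp x hx) (hr x hx) (h x hx))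
  rw [Finset.sum_add_distrib, Finset.sum_sub_distrib] at this
  unfold entN
  linarith

lemma list_sum_count [Fintype Z] [DecidableEq Z] (f : Z → ℝ) (c : List Z) :
    (c.map f).sum = ∑ z, (c.count z : ℝ) * f z := by
  induction c with
  | nil => simp
  | cons y u ih =>
    simp only [List.map_cons, List.sum_cons, ih, List.count_cons]
    push_cast
    simp only [add_mul, Finset.sum_add_distrib]
    simp [add_comm]

/-- Continuity of entropy in one direction, pointwise. -/
lemma cont_pt {p q c : ℝ} (hp : 0 ≤ p) (hq : 0 ≤ q) (hq1 : q ≤ 1) (hc : 0 < c) :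
    -(p * Real.log p) - -(q * Real.log q) ≤
      (|p - q| + (p - q)) / 2 * (-Real.log c - 1) + c + (|p - q| - (p - q)) / 2 := by
  rcases le_or_gt q p with h | h
  · rw [abs_of_nonneg (by linarith)]
    have h1 := gibbs_pt (p := p - q) (r := c) (by linarith) hc.le (fun e => absurd e hc.ne')
    have h2 : -(p * Real.log p) - -(q * Real.log q) ≤ -((p - q) * Real.log (p - q)) := by
      have a1 : q * Real.log q ≤ q * Real.log p := by
        rcases hq.eq_or_lt with rfl | hq
        · simp
        · exact mul_le_mul_of_nonneg_left (Real.log_le_log hq h) hq.le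
      have a2 : (p - q) * Real.log (p - q) ≤ (p - q) * Real.log p := by
        rcases h.eq_or_lt with rfl | h
        · simp
        · exact mul_le_mul_of_nonneg_left (Real.log_le_log (by linarith) (by linarith)) (by linarith)
      linarith
    nlinarith
  · rw [abs_of_neg (by linarith)]
    have hq' : 0 < q := by linarith
    have h1 := gibbs_pt (p := p) (r := q) hp hq (fun e => absurd e hq'.ne')
    have h2 : q * Real.log q ≤ p * Real.log q := by
      have := Real.log_nonpos hq hq1
      nlinarith
    nlinarith

/-- Weak Pinsker (via Hellinger): `‖p-q‖₁² ≤ 4 D`. -/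
lemma weak_pinsker [Fintype Z] (p q : Z → ℝ) (hp : ∀ z, 0 ≤ p z) (hq : ∀ z, 0 < q z)
    (hps : ∑ z, p z = 1) (hqs : ∑ z, q z = 1) :
    (∑ z, |p z - q z|) ^ 2 ≤ 4 * ∑ z, (p z * Real.log (p z) - p z * Real.log (q z)) := by
  have hD : ∑ z, (√(p z) - √(q z)) ^ 2 ≤
      ∑ z, (p z * Real.log (p z) - p z * Real.log (q z)) := by
    have : ∀ z ∈ (Finset.univ : Finset Z), (√(p z) - √(q z)) ^ 2 ≤
        (p z * Real.log (p z) - p z * Real.log (q z)) + (q z - p z) := by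
      intro z _
      have s1 := Real.sq_sqrt (hp z)
      have s2 := Real.sq_sqrt (hq z).le
      have r2 : 0 < √(q z) := Real.sqrt_pos.2 (hq z)
      rcases (hp z).eq_or_lt with h0 | h0
      · rw [← h0]; simp [s2]
      have r1 : 0 < √(p z) := Real.sqrt_pos.2 h0
      have := Real.log_le_sub_one_of_pos (div_pos r2 r1)
      rw [Real.log_div r2.ne' r1.ne', Real.log_sqrt (hq z).le, Real.log_sqrt h0.le] at this
      have h2 := mul_le_mul_of_nonneg_left this h0.le
      have e : p z * (√(q z) / √(p z) - 1) = √(p z) * √(q z) - p z := by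
        nth_rewrite 1 [← s1]
        field_simp
        linear_combination -s1
      rw [e] at h2
      nlinarith
    have := Finset.sum_le_sum this
    rw [Finset.sum_add_distrib, Finset.sum_sub_distrib (f := q), hps, hqs] at this
    linarith
  have h4 : ∑ z, (√(p z) + √(q z)) ^ 2 ≤ 4 := by
    have : ∀ z ∈ (Finset.univ : Finset Z), (√(p z) + √(q z)) ^ 2 ≤ 2 * p z + 2 * q z := by
      intro z _
      have s1 := Real.sq_sqrt (hp z)
      have s2 := Real.sq_sqrt (hq z).le
      nlinarith [sq_nonneg (√(p z) - √(q z))]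
    have := Finset.sum_le_sum this
    rw [Finset.sum_add_distrib, ← Finset.mul_sum, ← Finset.mul_sum, hps, hqs] at this
    linarith
  have cs := Finset.sum_mul_sq_le_sq_mul_sq Finset.univ (fun z => |√(p z) - √(q z)|)
    (fun z => √(p z) + √(q z))
  have e : ∀ z, |√(p z) - √(q z)| * (√(p z) + √(q z)) = |p z - q z| := by
    intro z
    have s1 := Real.sq_sqrt (hp z)
    have s2 := Real.sq_sqrt (hq z).le
    rw [← abs_of_nonneg (a := √(p z) + √(q z)) (by positivity), ← abs_mul]
    congr 1
    nlinarith
  simp only [e, sq_abs] at cs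
  have n1 : 0 ≤ ∑ z, (√(p z) - √(q z)) ^ 2 := Finset.sum_nonneg fun z _ => sq_nonneg _
  nlinarith

/-- the letter-level continuity bound (nats) -/
lemma ent_cont [Fintype Z] (hZ : 2 ≤ Fintype.card Z) (p q : Z → ℝ) (hp : ∀ z, 0 ≤ p z)
    (hq : ∀ z, 0 < q z) (hps : ∑ z, p z = 1) (hqs : ∑ z, q z = 1)
    (ε : ℝ) (hε0 : 0 < ε) (hε : ε ≤ 1 / 2)
    (hD : ∑ z, (p z * Real.log (p z) - p z * Real.log (q z)) ≤
      (ε ^ 2 / Real.log (Fintype.card Z) *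
        Real.log (Fintype.card Z / (Real.exp 1 * ε))) ^ 2 / 2) :
    entN Finset.univ p ≤ entN Finset.univ q +
      ε * Real.log ((Fintype.card Z : ℝ) ^ 2 / (Real.exp 1 * ε ^ 2)) := by
  set m : ℝ := (Fintype.card Z : ℝ) with hm
  have hm2 : (2 : ℝ) ≤ m := by rw [hm]; exact_mod_cast hZ
  have hm0 : 0 < m := by linarith
  have l2 := Real.log_two_gt_d9
  have l2' := Real.log_two_lt_d9
  have lm : Real.log 2 ≤ Real.log m := Real.log_le_log (by norm_num) hm2
  have lm0 : 0 < Real.log m := by linarith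
  have lε : Real.log ε ≤ -Real.log 2 := by
    rw [← Real.log_inv]; exact Real.log_le_log hε0 (by linarith)
  have e1 : Real.log (m / (Real.exp 1 * ε)) = Real.log m - 1 - Real.log ε := by
    rw [Real.log_div (by positivity) (by positivity), Real.log_mul (by positivity) (by positivity),
      Real.log_exp]; ring
  have e2 : Real.log (m ^ 2 / (Real.exp 1 * ε ^ 2)) = 2 * (Real.log m - Real.log ε) - 1 := by
    rw [Real.log_div (by positivity) (by positivity), Real.log_mul (by positivity) (by positivity),
      Real.log_exp, Real.log_pow, Real.log_pow]; push_cast; ring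
  rw [e1] at hD
  rw [e2]
  set θ := ε ^ 2 / Real.log m * (Real.log m - 1 - Real.log ε) with hθ
  have hθ0 : 0 ≤ θ := by
    apply mul_nonneg (by positivity); linarith
  have hθ1 : θ ≤ 7 / 10 * ε := by
    have g1 := gibbs_pt (p := ε) (r := 1 / 4) hε0.le (by norm_num) (by norm_num)
    have l4 : Real.log (1 / 4) = -(2 * Real.log 2) := by
      rw [show (1 / 4 : ℝ) = (2 ^ 2)⁻¹ by norm_num, Real.log_inv, Real.log_pow]; norm_num
    rw [l4] at g1
    have : ε * (Real.log m - 1 - Real.log ε) ≤ 7 / 10 * Real.log m := by nlinarith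
    rw [hθ, div_mul_eq_mul_div, div_le_iff₀ lm0]
    nlinarith
  have pk := weak_pinsker p q hp hq hps hqs
  set δ := ∑ z, |p z - q z| with hδ
  have hδε : δ ≤ ε := by
    apply le_of_sq_le_sq _ hε0.le
    nlinarith
  have hc : 0 < ε / m := by positivity
  have hq1 : ∀ z, q z ≤ 1 := fun z => by
    rw [← hqs]; exact Finset.single_le_sum (fun i _ => (hq i).le) (Finset.mem_univ z)
  have S := Finset.sum_le_sum (fun z (_ : z ∈ (Finset.univ : Finset Z)) =>
    cont_pt (hp z) (hq z).le (hq1 z) hc)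
  simp only [Finset.sum_add_distrib, Finset.sum_sub_distrib, ← Finset.sum_mul, ← Finset.sum_div,
    hps, hqs, Finset.sum_const, Finset.card_univ, nsmul_eq_mul, ← hm, ← hδ] at S
  rw [Real.log_div hε0.ne' hm0.ne', mul_div_cancel_left₀ _ hm0.ne'] at S
  unfold entN
  have : δ / 2 * (Real.log m - Real.log ε) ≤ ε / 2 * (Real.log m - Real.log ε) := by
    apply mul_le_mul_of_nonneg_right <;> linarith
  nlinarith

/-- Entropy of the leaf variable is bounded (nats). -/
lemma entY_le [Fintype Z] [DecidableEq Z] (hZ : 2 ≤ Fintype.card Z)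
    (PZ : Z → ℝ) (hZpos : ∀ z : Z, 0 < PZ z) (hZsum : ∑ z : Z, PZ z = 1)
    (C : Finset (List Z)) (hC : IsCompleteLeafSet C)
    (P : List Z → ℝ) (hP : ∀ c ∈ C, 0 ≤ P c) (hPs : ∑ c ∈ C, P c = 1)
    (hE : 0 < expLen C P)
    (ε : ℝ) (hε0 : 0 < ε) (hε : ε ≤ 1 / 2)
    (hD : (∑ c ∈ C, P c * Real.log (P c / inducedProb PZ c)) / expLen C P ≤
      (ε ^ 2 / Real.log (Fintype.card Z) *
        Real.log (Fintype.card Z / (Real.exp 1 * ε))) ^ 2 / 2) :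
    entN C P ≤ expLen C P * (entN Finset.univ PZ +
      ε * Real.log ((Fintype.card Z : ℝ) ^ 2 / (Real.exp 1 * ε ^ 2))) := by
  set E := expLen C P with hEdef
  let p : Z → ℝ := fun z => (∑ c ∈ C, P c * (c.count z : ℝ)) / E
  have hp : ∀ z, 0 ≤ p z := fun z =>
    div_nonneg (Finset.sum_nonneg fun c hc => mul_nonneg (hP c hc) (by positivity)) hE.le
  have lin : ∀ f : Z → ℝ, ∑ c ∈ C, P c * (c.map f).sum = E * ∑ z, p z * f z := by
    intro f
    rw [Finset.mul_sum]
    simp only [list_sum_count, Finset.mul_sum]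
    rw [Finset.sum_comm]
    refine Finset.sum_congr rfl fun z _ => ?_
    have : E * (p z * f z) = (∑ c ∈ C, P c * (c.count z : ℝ)) * f z := by
      simp only [p]; field_simp
    rw [this, Finset.sum_mul]
    refine Finset.sum_congr rfl fun c _ => by ring
  have hps : ∑ z, p z = 1 := by
    have := lin (fun _ => 1)
    simp only [List.map_const', List.sum_replicate, nsmul_eq_mul, mul_one] at this
    have h2 : E = E * ∑ z, p z := this
    have : E * (∑ z, p z - 1) = 0 := by linarith
    rcases mul_eq_zero.1 this with h | h
    · exact absurd h hE.ne'
    · linarith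
  have hpz : ∀ c ∈ C, inducedProb p c = 0 → P c = 0 := by
    intro c hc h0
    unfold inducedProb at h0
    rw [List.prod_eq_zero_iff, List.mem_map] at h0
    obtain ⟨z, hz, hz0⟩ := h0
    simp only [p, div_eq_zero_iff, hE.ne', or_false] at hz0
    rw [Finset.sum_eq_zero_iff_of_nonneg
      (fun c hc => mul_nonneg (hP c hc) (by positivity))] at hz0
    rcases mul_eq_zero.1 (hz0 c hc) with h | h
    · exact h
    · have := List.count_pos_iff.2 hz
      have h' : c.count z = 0 := by exact_mod_cast h
      omega
  have H1 : entN C P ≤ E * entN Finset.univ p := by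
    have := gibbs C P (inducedProb p) hP (fun c _ => inducedProb_nonneg p hp c) hpz
      (by rw [sum_inducedProb p hps C hC, hPs])
    refine this.trans (le_of_eq ?_)
    have e := lin (fun z => Real.log (p z))
    rw [entN, Finset.sum_neg_distrib, Finset.sum_neg_distrib, mul_neg, ← e]
    congr 1
    refine Finset.sum_congr rfl fun c hc => ?_
    by_cases h0 : inducedProb p c = 0
    · simp [hpz c hc h0]
    · rw [log_inducedProb p c h0]
  have H2 : ∑ c ∈ C, P c * Real.log (P c / inducedProb PZ c) =
      - entN C P - E * ∑ z, p z * Real.log (PZ z) := by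
    rw [← lin (fun z => Real.log (PZ z)), entN, Finset.sum_neg_distrib, neg_neg,
      ← Finset.sum_sub_distrib]
    refine Finset.sum_congr rfl fun c hc => ?_
    have hpos : inducedProb PZ c ≠ 0 := by
      unfold inducedProb
      rw [Ne, List.prod_eq_zero_iff, List.mem_map]
      rintro ⟨z, _, hz⟩
      exact (hZpos z).ne' hz
    by_cases h0 : P c = 0
    · simp [h0]
    · rw [Real.log_div h0 hpos, log_inducedProb PZ c hpos]; ring
  have H3 : ∑ z, (p z * Real.log (p z) - p z * Real.log (PZ z)) ≤
      (∑ c ∈ C, P c * Real.log (P c / inducedProb PZ c)) / E := by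
    rw [le_div_iff₀ hE, H2, Finset.sum_sub_distrib]
    have H0 : entN Finset.univ p = -∑ z, p z * Real.log (p z) := by
      rw [entN, Finset.sum_neg_distrib]
    rw [H0] at H1
    nlinarith
  have := ent_cont hZ p PZ hp hZpos hps hZsum ε hε0 hε (H3.trans hD)
  exact H1.trans (mul_le_mul_of_nonneg_left this hE.le)

/-- Fano (nats). -/
lemma fano {α β : Type*} [DecidableEq α] (A : Finset α) (B : Finset β) (P : α → β → ℝ)
    (hnn : ∀ a ∈ A, ∀ b ∈ B, 0 ≤ P a b) (PA : α → ℝ) (hA : ∀ a ∈ A, ∑ b ∈ B, P a b = PA a)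
    (hs : ∑ a ∈ A, PA a = 1) (g : β → α) (hg : ∀ b ∈ B, g b ∈ A) (e : ℝ)
    (hPe : ∑ a ∈ A, ∑ b ∈ B.filter (fun b => g b ≠ a), P a b ≤ e) (he : e ≤ 1 / 2) :
    entN A PA ≤ entN B (fun b => ∑ a ∈ A, P a b) +
      (-(e * Real.log e) - (1 - e) * Real.log (1 - e) + e * Real.log A.card) := by
  have hPe0 : 0 ≤ ∑ a ∈ A, ∑ b ∈ B.filter (fun b => g b ≠ a), P a b :=
    Finset.sum_nonneg fun a ha => Finset.sum_nonneg fun b hb =>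
      hnn a ha b (Finset.mem_filter.1 hb).1
  set Pe := ∑ a ∈ A, ∑ b ∈ B.filter (fun b => g b ≠ a), P a b with hPedef
  have he0 : 0 ≤ e := hPe0.trans hPe
  have hAne : A.Nonempty := by
    by_contra h
    rw [Finset.not_nonempty_iff_eq_empty] at h
    simp [h] at hs
  have hcard : (1 : ℝ) ≤ A.card := by exact_mod_cast hAne.card_pos
  set M : ℝ := (A.card : ℝ) with hM
  set PB : β → ℝ := fun b => ∑ a ∈ A, P a b with hPB
  have hPBnn : ∀ b ∈ B, 0 ≤ PB b := fun b hb => Finset.sum_nonneg fun a ha => hnn a ha b hb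
  have hBs : ∑ b ∈ B, PB b = 1 := by
    rw [hPB, Finset.sum_comm, ← hs]
    exact Finset.sum_congr rfl hA
  have hle : ∀ a ∈ A, ∀ b ∈ B, P a b ≤ PB b := fun a ha b hb =>
    Finset.single_le_sum (f := fun a => P a b) (fun i hi => hnn i hi b hb) ha
  have hleA : ∀ a ∈ A, ∀ b ∈ B, P a b ≤ PA a := fun a ha b hb => by
    rw [← hA a ha]; exact Finset.single_le_sum (f := fun b => P a b) (fun i hi => hnn a ha i hi) hb
  let w : α → β → ℝ := fun a b => if g b ≠ a then e / M else 1 - e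
  have hPe' : Pe = ∑ a ∈ A, ∑ b ∈ B, if g b ≠ a then P a b else 0 := by
    simp only [hPedef, Finset.sum_filter]
  have hzero : e = 0 → ∀ a ∈ A, ∀ b ∈ B, g b ≠ a → P a b = 0 := by
    intro h0 a ha b hb hne
    have hz : Pe = 0 := by linarith
    rw [hPedef, Finset.sum_eq_zero_iff_of_nonneg (fun a ha => Finset.sum_nonneg fun b hb =>
      hnn a ha b (Finset.mem_filter.1 hb).1)] at hz
    have := hz a ha
    rw [Finset.sum_eq_zero_iff_of_nonneg (fun b hb => hnn a ha b (Finset.mem_filter.1 hb).1)] at this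
    exact this b (Finset.mem_filter.2 ⟨hb, hne⟩)
  -- joint entropy
  have J1 : entN A PA ≤ entN (A ×ˢ B) (fun x => P x.1 x.2) := by
    unfold entN
    rw [Finset.sum_product]
    refine Finset.sum_le_sum fun a ha => ?_
    rw [← hA a ha, Finset.sum_mul, ← Finset.sum_neg_distrib, hA a ha]
    refine Finset.sum_le_sum fun b hb => ?_
    rcases (hnn a ha b hb).eq_or_lt with h | h
    · simp [← h]
    · have := mul_le_mul_of_nonneg_left (Real.log_le_log h (hleA a ha b hb)) h.le
      simpa using this
  have hwnn : ∀ a b, 0 ≤ w a b := by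
    intro a b
    simp only [w]
    split_ifs
    · positivity
    · linarith
  have J2 : entN (A ×ˢ B) (fun x => P x.1 x.2) ≤
      ∑ x ∈ A ×ˢ B, -(P x.1 x.2 * Real.log (PB x.2 * w x.1 x.2)) := by
    apply gibbs
    · rintro ⟨a, b⟩ h
      rw [Finset.mem_product] at h
      exact hnn a h.1 b h.2
    · rintro ⟨a, b⟩ h
      rw [Finset.mem_product] at h
      exact mul_nonneg (hPBnn b h.2) (hwnn a b)
    · rintro ⟨a, b⟩ h h0
      rw [Finset.mem_product] at h
      simp only at h h0 ⊢
      rcases mul_eq_zero.1 h0 with h0 | h0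
      · have := hle a h.1 b h.2
        have := hnn a h.1 b h.2
        linarith
      · simp only [w] at h0
        split_ifs at h0 with hne
        · exact hzero (by
            rcases div_eq_zero_iff.1 h0 with h | h
            · exact h
            · linarith) a h.1 b h.2 hne
        · linarith
    · rw [Finset.sum_product, Finset.sum_product, Finset.sum_congr rfl hA, hs, Finset.sum_comm,
        ← hBs]
      refine Finset.sum_le_sum fun b hb => ?_
      simp only
      rw [← Finset.mul_sum]
      refine mul_le_of_le_one_right (hPBnn b hb) ?_
      have : ∀ a ∈ A, w a b ≤ e / M + if g b = a then 1 - e else 0 := by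
        intro a _
        have : 0 ≤ e / M := by positivity
        simp only [w]
        split_ifs <;> simp_all
      refine (Finset.sum_le_sum this).trans ?_
      rw [Finset.sum_add_distrib, Finset.sum_ite_eq, if_pos (hg b hb), Finset.sum_const,
        nsmul_eq_mul, ← hM, mul_div_cancel₀ _ (by linarith)]
      linarith
  have J3 : ∑ x ∈ A ×ˢ B, -(P x.1 x.2 * Real.log (PB x.2 * w x.1 x.2)) =
      entN B PB - (1 - Pe) * Real.log (1 - e) - Pe * Real.log (e / M) := by
    have t1 : ∑ a ∈ A, ∑ b ∈ B, P a b * Real.log (PB b) = -entN B PB := by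
      rw [Finset.sum_comm, entN, Finset.sum_neg_distrib, neg_neg]
      refine Finset.sum_congr rfl fun b _ => by rw [← Finset.sum_mul]
    have t2 : ∑ a ∈ A, ∑ b ∈ B, P a b = 1 := by rw [Finset.sum_congr rfl hA, hs]
    have t3 : ∑ x ∈ A ×ˢ B, -(P x.1 x.2 * Real.log (PB x.2 * w x.1 x.2)) =
        ∑ a ∈ A, ∑ b ∈ B, (-(P a b * Real.log (PB b)) - P a b * Real.log (1 - e)
          - (if g b ≠ a then P a b else 0) * (Real.log (e / M) - Real.log (1 - e))) := by
      rw [Finset.sum_product]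
      refine Finset.sum_congr rfl fun a ha => Finset.sum_congr rfl fun b hb => ?_
      simp only
      by_cases h0 : P a b = 0
      · simp [h0]
      have hPb : PB b ≠ 0 := by
        have := hle a ha b hb
        have := lt_of_le_of_ne (hnn a ha b hb) (Ne.symm h0)
        linarith
      by_cases hne : g b ≠ a
      · have hene : e ≠ 0 := fun h => h0 (hzero h a ha b hb hne)
        have hM0 : M ≠ 0 := by linarith
        simp only [w, if_pos hne]
        rw [Real.log_mul hPb (div_ne_zero hene hM0)]
        ring
      · simp only [w, if_neg hne]
        rw [Real.log_mul hPb (by linarith)]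
        ring
    rw [t3]
    simp only [Finset.sum_sub_distrib, Finset.sum_neg_distrib, ← Finset.sum_mul]
    rw [t1, t2, ← hPe']
    ring
  have J4 : - (1 - Pe) * Real.log (1 - e) - Pe * Real.log (e / M) ≤
      -(e * Real.log e) - (1 - e) * Real.log (1 - e) + e * Real.log M := by
    rcases he0.eq_or_lt with h | h
    · have : Pe = 0 := by linarith
      rw [this, ← h]; simp
    · rw [Real.log_div h.ne' (by linarith)]
      have a1 : Real.log e ≤ Real.log (1 - e) := Real.log_le_log h (by linarith)
      have a2 : 0 ≤ Real.log M := Real.log_nonneg hcard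
      nlinarith [mul_nonneg (sub_nonneg.2 hPe) (add_nonneg (sub_nonneg.2 a1) a2)]
  linarith

end REC

/-- **Converse for random encoders (distribution matching).** With `m = |Z| ≥ 2`,
`θ(ε) = (ε²/log₂ m) log₂(m/(eε))` and `σ(ε) = ε log₂(m²/(eε²))` for `0 < ε ≤ 1/2`:
if the decoding error probability satisfies `P_e ≤ ε' ≤ 1/2` and
`D(P_Y ‖ P_Z^C)/E[ℓ(Y)] ≤ θ(ε)²/(2 ln 2)`, then
`E[ℓ(D)]/E[ℓ(Y)] ≤ H(P_Z)/H(P_X) + σ(ε)/H(P_X) + (H₂(ε') + ε' log₂|Dic|)/(E[ℓ(Y)] H(P_X))`. -/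
theorem random_encoder_converse {X Z : Type*}
    [Fintype X] [DecidableEq X] [Fintype Z] [DecidableEq Z]
    (hZ : 2 ≤ Fintype.card Z)
    (PX : X → ℝ) (hXnn : ∀ x : X, 0 ≤ PX x) (hXsum : ∑ x : X, PX x = 1)
    (hHX : 0 < ent Finset.univ PX)
    (PZ : Z → ℝ) (hZpos : ∀ z : Z, 0 < PZ z) (hZsum : ∑ z : Z, PZ z = 1)
    (Dic : Finset (List X)) (hDic : IsCompleteLeafSet Dic)
    (C : Finset (List Z)) (hC : IsCompleteLeafSet C)
    (PDY : List X → List Z → ℝ)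
    (hnn : ∀ d ∈ Dic, ∀ c ∈ C, 0 ≤ PDY d c)
    (hmargD : ∀ d ∈ Dic, ∑ c ∈ C, PDY d c = inducedProb PX d)
    (g : List Z → List X) (hg : ∀ c ∈ C, g c ∈ Dic)
    (ε' : ℝ)
    (hPe : ∑ d ∈ Dic, ∑ c ∈ C.filter (fun c => g c ≠ d), PDY d c ≤ ε')
    (hε' : ε' ≤ 1 / 2)
    (ε : ℝ) (hε0 : 0 < ε) (hε : ε ≤ 1 / 2)
    (hdiv : kl C (margY Dic PDY) (inducedProb PZ) / expLen C (margY Dic PDY) ≤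
      (ε ^ 2 / Real.logb 2 (Fintype.card Z) *
        Real.logb 2 (Fintype.card Z / (Real.exp 1 * ε))) ^ 2 / (2 * Real.log 2)) :
    expLen Dic (inducedProb PX) / expLen C (margY Dic PDY) ≤
      ent Finset.univ PZ / ent Finset.univ PX +
        ε * Real.logb 2 ((Fintype.card Z : ℝ) ^ 2 / (Real.exp 1 * ε ^ 2)) /
          ent Finset.univ PX +
        (binEnt ε' + ε' * Real.logb 2 (Dic.card)) /
          (expLen C (margY Dic PDY) * ent Finset.univ PX) := by
  have L2 : 0 < Real.log 2 := Real.log_pos (by norm_num)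
  have hPDs := REC.sum_inducedProb PX hXsum Dic hDic
  set PY := margY Dic PDY with hPY
  have hPYnn : ∀ c ∈ C, 0 ≤ PY c := fun c hc =>
    Finset.sum_nonneg fun d hd => hnn d hd c hc
  have hPYs : ∑ c ∈ C, PY c = 1 := by
    rw [← hPDs, ← Finset.sum_congr rfl hmargD, Finset.sum_comm]
    rfl
  have hE : 0 < expLen C PY := by
    have : ∑ c ∈ C, PY c ≤ expLen C PY := by
      refine Finset.sum_le_sum fun c hc => le_mul_of_one_le_right (hPYnn c hc) ?_
      exact_mod_cast List.length_pos_iff.2 (hC.1 c hc)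
    linarith
  have F := REC.fano Dic C PDY hnn (inducedProb PX) hmargD hPDs g hg ε' hPe hε'
  have Y := REC.entY_le hZ PZ hZpos hZsum C hC PY hPYnn hPYs hE ε hε0 hε (by
    have e1 : ∑ c ∈ C, PY c * Real.log (PY c / inducedProb PZ c)
        = Real.log 2 * kl C PY (inducedProb PZ) := by
      unfold kl Real.logb
      rw [Finset.mul_sum]
      refine Finset.sum_congr rfl fun c _ => by field_simp
    have e2 : ∀ a b : ℝ, ε ^ 2 / Real.logb 2 a * Real.logb 2 b
        = ε ^ 2 / Real.log a * Real.log b := by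
      intro a b
      unfold Real.logb
      field_simp
    rw [e2] at hdiv
    rw [e1, mul_div_assoc]
    refine (mul_le_mul_of_nonneg_left hdiv L2.le).trans (le_of_eq ?_)
    field_simp)
  have F' : REC.entN Finset.univ PX * expLen Dic (inducedProb PX) ≤
      expLen C PY * (REC.entN Finset.univ PZ +
      ε * Real.log ((Fintype.card Z : ℝ) ^ 2 / (Real.exp 1 * ε ^ 2))) +
      (-(ε' * Real.log ε') - (1 - ε') * Real.log (1 - ε') + ε' * Real.log Dic.card) := by
    rw [← REC.ent_leaf PX hXsum Dic hDic]
    exact F.trans (add_le_add_left Y _)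
  rw [REC.ent_eq] at hHX
  have hX : 0 < REC.entN Finset.univ PX := by
    have := mul_pos hHX L2
    rwa [div_mul_cancel₀ _ L2.ne'] at this
  rw [REC.ent_eq, REC.ent_eq]
  unfold binEnt Real.logb
  set hx := REC.entN Finset.univ PX
  set hz := REC.entN Finset.univ PZ
  set E := expLen C PY
  set s := Real.log ((Fintype.card Z : ℝ) ^ 2 / (Real.exp 1 * ε ^ 2))
  have key : hz / Real.log 2 / (hx / Real.log 2) + ε * (s / Real.log 2) / (hx / Real.log 2) +
      (-(ε' * (Real.log ε' / Real.log 2)) - (1 - ε') * (Real.log (1 - ε') / Real.log 2) +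
        ε' * (Real.log Dic.card / Real.log 2)) / (E * (hx / Real.log 2)) =
      (E * (hz + ε * s) +
      (-(ε' * Real.log ε') - (1 - ε') * Real.log (1 - ε') + ε' * Real.log Dic.card)) / hx / E := by
    field_simp
  rw [key]
  refine div_le_div_of_nonneg_right ?_ hE.le
  rw [le_div_iff₀ hX]
  linarith
end
end
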